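/- Recurrence (5.18) in the proof of Theorem 3.1 (obtained by Kuo condensation): Let x,y,n be nonnegative integers with y > 0, let U, D ⊆ [x+y+n] with |U∪D| = n, let B ⊆ [x+y+n]\(U∪D) with |B| < x, and let α and β (α < β) be the first and last positions of [x+y+n]\(U∪D∪B). Then M(F̄_{x,y}(U;D;B)) · M(F̄_{x−1,y−1}(U∪{α,β};D;B)) = M(F̄_{x−1,y}(U∪{β};D;B)) · M(F̄_{x,y−1}(U∪{α};D;B)) + M(F̄_{x−1,y}(U∪{α};D;B)) · M(F̄_{x,y−1}(U∪{β};D;B)). -/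

import Mathlib

open Finset

/-- A unit triangle of the triangular lattice, in sheared coordinates:
`(true, a, j)` is the up-pointing triangle with horizontal base
`[a + j/2, a + 1 + j/2]` on the lattice line at height `j`;
`(false, a, j)` is the down-pointing triangle with apex `(a + 1 + j/2, j)`
and top edge on the lattice line at height `j + 1`. -/
abbrev Tri : Type := Bool × ℤ × ℤ

def upT (a j : ℤ) : Tri := (true, a, j)
def dnT (a j : ℤ) : Tri := (false, a, j)

/-- A lozenge (union of two unit triangles sharing an edge), recorded by the
coordinates of its up-pointing triangle (first component) and of its
down-pointing triangle (second component). -/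
abbrev Loz : Type := (ℤ × ℤ) × (ℤ × ℤ)

/-- The two triangles of a lozenge share an edge: the down-pointing triangle is
the right, left or lower neighbour of the up-pointing one. -/
def lozAdj (l : Loz) : Prop :=
  l.2 = l.1 ∨ l.2 = (l.1.1 - 1, l.1.2) ∨ l.2 = (l.1.1, l.1.2 - 1)

/-- `T` is a lozenge tiling of the region `R`: it consists of lozenges lying in
`R` and covers every unit triangle of `R` exactly once. -/
def IsTiling (R : Finset Tri) (T : Finset Loz) : Prop :=
  (∀ l ∈ T, lozAdj l ∧ upT l.1.1 l.1.2 ∈ R ∧ dnT l.2.1 l.2.2 ∈ R) ∧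
  (∀ t ∈ R, ∃! l, l ∈ T ∧ (t = upT l.1.1 l.1.2 ∨ t = dnT l.2.1 l.2.2))

/-- All lozenge tilings of `R` avoiding the forbidden lozenges in `F`
(the barriers), collected in a finset. -/
noncomputable def tilings (R : Finset Tri) (F : Finset Loz) : Finset (Finset Loz) := by
  classical
  exact ((R.image Prod.snd ×ˢ R.image Prod.snd).powerset).filter
    (fun T => IsTiling R T ∧ ∀ l ∈ T, l ∉ F)

/-- `Mtil R F` : the number of lozenge tilings of `R` avoiding the barriers `F`. -/
noncomputable def Mtil (R : Finset Tri) (F : Finset Loz) : ℕ := (tilings R F).card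

/-- Weighted tiling number: each lozenge in `Wt` carries weight `1/2`, all other
lozenges weight `1`; a tiling is weighted by the product of its lozenge weights. -/
noncomputable def Mw (R : Finset Tri) (F : Finset Loz) (Wt : Finset Loz) : ℚ :=
  ∑ T ∈ tilings R F, (1 / 2 : ℚ) ^ (T ∩ Wt).card

/-- Reflection of a unit triangle over the horizontal lattice line `l` (height `0`). -/
def reflTri (t : Tri) : Tri :=
  if t.1 then (false, t.2.1 + t.2.2, -t.2.2 - 1) else (true, t.2.1 + t.2.2 + 1, -t.2.2 - 1)

/-- Reflection of a lozenge over the horizontal lattice line `l` (height `0`). -/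
def reflLoz (l : Loz) : Loz :=
  ((l.2.1 + l.2.2 + 1, -l.2.2 - 1), (l.1.1 + l.1.2, -l.1.2 - 1))

/-- The up-pointing unit triangles removed at the positions of `U`
(1-indexed, from left to right) just above the line `l`. -/
def upDents (U : Finset ℕ) : Finset Tri := U.image (fun (i : ℕ) => upT ((i : ℤ) - 1) 0)

/-- The down-pointing unit triangles removed at the positions of `D`
(1-indexed, from left to right) just below the line `l`. -/
def dnDents (D : Finset ℕ) : Finset Tri := D.image (fun (i : ℕ) => dnT ((i : ℤ) - 1) (-1))

/-- The vertical lozenges straddling the line `l` at the barrier positions `B`: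
these are forbidden in any tiling. -/
def barrierLoz (B : Finset ℕ) : Finset Loz :=
  B.image (fun (i : ℕ) => (((i : ℤ) - 1, 0), ((i : ℤ) - 1, -1)))

/-- The upper half of a hexagon: the semihexagon (trapezoid) with base `W` on the
line `l` and `h` rows of unit triangles above it. -/
def upperHex (W h : ℕ) : Finset Tri :=
  (Finset.range h).biUnion fun j =>
    ((Finset.range (W - j)).image fun (a : ℕ) => upT (a : ℤ) (j : ℤ)) ∪
    ((Finset.range (W - j - 1)).image fun (a : ℕ) => dnT (a : ℤ) (j : ℤ))

/-- The doubly-dented hexagon `H_{x,y}(U; D)` (with `n = |U ∪ D|` recorded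
explicitly): the hexagon of side lengths `x+n-u, y+u, y+d, x+n-d, y+d, y+u`
(clockwise from the north side) with the up-pointing unit triangles at the
positions of `U` and the down-pointing unit triangles at the positions of `D`
removed along the horizontal axis `l` through its west and east vertices. -/
def Hreg (x y n : ℕ) (U D : Finset ℕ) : Finset Tri :=
  (upperHex (x + y + n) (y + U.card) \ upDents U) ∪
  ((upperHex (x + y + n) (y + D.card)).image reflTri \ dnDents D)

/-- The quartered hexagon `L_{m,n}(A)`: the trapezoid whose northern,
northeastern, southern sides have lengths `n`, `m`, `n + ⌊(m+1)/2⌋` and whose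
western side is a vertical zigzag of `m` steps, with the up-pointing unit
triangles at the positions of `A` removed from the base. -/
def Lreg (m n : ℕ) (A : Finset ℕ) : Finset Tri :=
  ((Finset.range m).biUnion fun j =>
    ((Finset.range (n + (m + 1) / 2 + j / 2 - j)).image
        fun (a : ℕ) => upT ((a : ℤ) - ((j / 2 : ℕ) : ℤ)) (j : ℤ)) ∪
    ((Finset.range (n + (m + 1) / 2 + (j + 1) / 2 - (j + 1))).image
        fun (a : ℕ) => dnT ((a : ℤ) - (((j + 1) / 2 : ℕ) : ℤ)) (j : ℤ)))
  \ upDents A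

/-- The vertical lozenges sitting along (the bumps of) the western zigzag side
of the quartered hexagon `L_{m,n}`; these get weight `1/2` in `L̄_{m,n}`. -/
def westLoz (m : ℕ) : Finset Loz :=
  ((Finset.range m).filter fun j => j % 2 = 1).image fun j =>
    ((-(((j - 1) / 2 : ℕ) : ℤ), (j : ℤ)), (-(((j - 1) / 2 : ℕ) : ℤ), (j : ℤ) - 1))

/-- The doubly-dented halved hexagon `F_{x,y}(U; D)`: north, northeast,
southeast, south sides of lengths `x+n-u, 2y+2u, 2y+2d, x+n-d`, western side a
vertical zigzag with `4y+2u+2d` steps, with up-dents `U` and down-dents `D`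
along the horizontal line `l` through the east vertex. -/
def Freg (x y n : ℕ) (U D : Finset ℕ) : Finset Tri :=
  Lreg (2 * y + 2 * U.card) (x + n - U.card) U ∪
  (Lreg (2 * y + 2 * D.card) (x + n - D.card) D).image reflTri

/-- The doubly-dented halved hexagon `F̄_{x,y}(U; D)`: side lengths
`x+n-u, 2y-1+2u, 2y-1+2d, x+n-d` and a western zigzag with `4y+2u+2d-2` steps,
with up-dents `U` and down-dents `D` along the line `l` through the east vertex. -/
def Fbar (x y n : ℕ) (U D : Finset ℕ) : Finset Tri :=
  Lreg (2 * y + 2 * U.card - 1) (x + n - U.card) U ∪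
  (Lreg (2 * y + 2 * D.card - 1) (x + n - D.card) D).image reflTri

/-- The weight-`1/2` vertical lozenges on the western side of `W_{x,y}(U;D;B)`
(where `u = |U|`, `d = |D|`). -/
def wtW (y u d : ℕ) : Finset Loz :=
  westLoz (2 * y + 2 * u) ∪ (westLoz (2 * y + 2 * d)).image reflLoz

/-- The weight-`1/2` vertical lozenges on the western side of `W̄_{x,y}(U;D;B)`. -/
def wtWbar (y u d : ℕ) : Finset Loz :=
  westLoz (2 * y + 2 * u - 1) ∪ (westLoz (2 * y + 2 * d - 1)).image reflLoz

/-- `m - S = {m - s : s ∈ S}`. -/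
def mirrorSet (m : ℕ) (S : Finset ℕ) : Finset ℕ := S.image fun i => m - i

/-- The reflectively symmetric doubly-dented hexagon
`RS_{x,y}(U;D) = H_{x,y}(U ∪ ((x+y+2n+1)-U); D ∪ ((x+y+2n+1)-D))`. -/
def RSreg (x y n : ℕ) (U D : Finset ℕ) : Finset Tri :=
  Hreg x y (2 * n) (U ∪ mirrorSet (x + y + 2 * n + 1) U)
    (D ∪ mirrorSet (x + y + 2 * n + 1) D)

/-- Reflection of a lozenge over the vertical symmetry axis of a region whose
base on the line `l` spans the horizontal interval `[0, W]`. -/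
def vreflLoz (W : ℤ) (l : Loz) : Loz :=
  ((W - 1 - l.1.1 - l.1.2, l.1.2), (W - 2 - l.2.1 - l.2.2, l.2.2))

/-- The number of lozenge tilings of `R` (avoiding the barriers `F`) invariant
under the reflection over the vertical axis of a base of width `W`. -/
noncomputable def Msym (R : Finset Tri) (F : Finset Loz) (W : ℤ) : ℕ := by
  classical
  exact ((tilings R F).filter fun T => T.image (vreflLoz W) = T).card

/-- `M_r(RS_{x,y}(U;D;B))` : the number of reflectively symmetric lozenge
tilings of the symmetric doubly-dented hexagon with barriers at
`B ∪ ((x+y+2n+1)-B)`. -/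
noncomputable def Mr (x y n : ℕ) (U D B : Finset ℕ) : ℕ :=
  Msym (RSreg x y n U D)
    (barrierLoz (B ∪ mirrorSet (x + y + 2 * n + 1) B))
    ((x : ℤ) + (y : ℤ) + 2 * (n : ℤ))

/-- The skipping hyperfactorial: `H2 (2k) = 0! 2! ⋯ (2k-2)!` and
`H2 (2k+1) = 1! 3! ⋯ (2k-1)!`. -/
def H2 (n : ℕ) : ℕ :=
  ∏ j ∈ (Finset.range n).filter (fun j => j % 2 = n % 2), Nat.factorial j

/-- `∏_{1 ≤ i < j ≤ k} (s_j² - s_i²)` for the increasing enumeration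
`s_1 < ⋯ < s_k` of `S`. -/
def prodDiffSq (S : Finset ℕ) : ℚ :=
  ∏ p ∈ S, ∏ q ∈ S.filter (fun q => p < q), ((q : ℚ) ^ 2 - (p : ℚ) ^ 2)

/-- `∏_{1 ≤ i < j ≤ k} (s_j - s_i)`. -/
def prodDiff (S : Finset ℕ) : ℚ :=
  ∏ p ∈ S, ∏ q ∈ S.filter (fun q => p < q), ((q : ℚ) - (p : ℚ))

/-- `∏_{1 ≤ i < j ≤ k} (s_j - s_i)(s_j + s_i - 1)`. -/
def prodDS1 (S : Finset ℕ) : ℚ :=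
  ∏ p ∈ S, ∏ q ∈ S.filter (fun q => p < q), (((q : ℚ) - (p : ℚ)) * ((q : ℚ) + (p : ℚ) - 1))

/-- `∏_{1 ≤ i < j ≤ k} (s_j - s_i)(s_j + s_i - 2)`. -/
def prodDS2 (S : Finset ℕ) : ℚ :=
  ∏ p ∈ S, ∏ q ∈ S.filter (fun q => p < q), (((q : ℚ) - (p : ℚ)) * ((q : ℚ) + (p : ℚ) - 2))

/-- `∏_{1 ≤ i < j ≤ k} (s_i + s_j)`. -/
def prodSum0 (S : Finset ℕ) : ℚ :=
  ∏ p ∈ S, ∏ q ∈ S.filter (fun q => p < q), ((q : ℚ) + (p : ℚ))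

/-- `∏_{1 ≤ i < j ≤ k} (s_i + s_j - 1)`. -/
def prodSum1 (S : Finset ℕ) : ℚ :=
  ∏ p ∈ S, ∏ q ∈ S.filter (fun q => p < q), ((q : ℚ) + (p : ℚ) - 1)

/-- `∏_{1 ≤ i < j ≤ k} (s_i + s_j - 2)`. -/
def prodSum2 (S : Finset ℕ) : ℚ :=
  ∏ p ∈ S, ∏ q ∈ S.filter (fun q => p < q), ((q : ℚ) + (p : ℚ) - 2)

/-- `∏_{1 ≤ i ≤ j ≤ k} (s_i + s_j - 1)` (the diagonal `i = j` included). -/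
def prodSumLe1 (S : Finset ℕ) : ℚ :=
  ∏ p ∈ S, ∏ q ∈ S.filter (fun q => p ≤ q), ((q : ℚ) + (p : ℚ) - 1)



/-- The three-term Plücker relation for determinants sharing all but two rows. -/
lemma det_plucker {n : ℕ} (r : Fin n → Fin (n + 2) → ℚ) (a b c d : Fin (n + 2) → ℚ) :
    Matrix.det (Matrix.of (Matrix.vecCons a (Matrix.vecCons b r))) *
        Matrix.det (Matrix.of (Matrix.vecCons c (Matrix.vecCons d r))) +
      Matrix.det (Matrix.of (Matrix.vecCons b (Matrix.vecCons c r))) *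
        Matrix.det (Matrix.of (Matrix.vecCons a (Matrix.vecCons d r))) +
      Matrix.det (Matrix.of (Matrix.vecCons c (Matrix.vecCons a r))) *
        Matrix.det (Matrix.of (Matrix.vecCons b (Matrix.vecCons d r))) = 0 := by
  set A : Matrix (Fin (n + 2)) (Fin (n + 2)) ℚ :=
    Matrix.of (Matrix.vecCons a (Matrix.vecCons b r)) with hA
  set f : (Fin (n + 2) → ℚ) → ℚ := fun v =>
    Matrix.det (Matrix.of (Matrix.vecCons v (Matrix.vecCons d r))) with hf
  have hswap : ∀ p q : Fin (n + 2) → ℚ,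
      Matrix.det (Matrix.of (Matrix.vecCons p (Matrix.vecCons q r))) =
        - Matrix.det (Matrix.of (Matrix.vecCons q (Matrix.vecCons p r))) := by
    intro p q
    have h := Matrix.det_permute (Equiv.swap (0 : Fin (n + 2)) 1)
      (Matrix.of (Matrix.vecCons q (Matrix.vecCons p r)))
    rw [Equiv.Perm.sign_swap (by simp)] at h
    rw [show (Matrix.of (Matrix.vecCons p (Matrix.vecCons q r))) =
      (Matrix.of (Matrix.vecCons q (Matrix.vecCons p r))).submatrix
        (Equiv.swap (0 : Fin (n + 2)) 1) id from ?_, h]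
    · simp
    · ext i j
      refine Fin.cases ?_ (fun i => Fin.cases ?_ (fun i => ?_) i) i
      · simp
      · simp
      · rw [Matrix.submatrix_apply, Equiv.swap_apply_of_ne_of_ne (by simp)
          (by simp [Fin.ext_iff])]
        simp
  have hcr : ∀ j, ∑ i, A i j * Matrix.cramer A.transpose c i = A.det * c j := by
    intro j
    have h := congrFun (Matrix.mulVec_cramer A.transpose c) j
    simpa [Matrix.mulVec, dotProduct, Matrix.det_transpose] using h
  have hlin : A.det * f c = ∑ i, Matrix.cramer A.transpose c i * f (A i) := by
    let g : (Fin (n + 2) → ℚ) →ₗ[ℚ] ℚ :=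
      (Matrix.detRowAlternating (n := Fin (n + 2)) (R := ℚ)).toMultilinearMap.toLinearMap
        (Matrix.vecCons 0 (Matrix.vecCons d r)) 0
    have hg : ∀ v, g v = f v := by
      intro v
      simp only [g, MultilinearMap.toLinearMap_apply, hf]
      change Matrix.det _ = _
      congr 1
      ext i j
      refine Fin.cases ?_ (fun i => ?_) i <;> simp [Function.update]
    simp only [← hg]
    rw [show A.det * g c = g (A.det • c) by simp]
    rw [show A.det • c = ∑ i, Matrix.cramer A.transpose c i • A i by
      ext j; rw [Pi.smul_apply, smul_eq_mul, ← hcr j, Finset.sum_apply]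
      exact Finset.sum_congr rfl fun i _ => by simp [mul_comm]]
    simp [map_sum]
  rw [Fin.sum_univ_succ, Fin.sum_univ_succ, Finset.sum_eq_zero (s := univ)] at hlin
  · rw [Matrix.cramer_transpose_apply, Matrix.cramer_transpose_apply] at hlin
    have e0 : A.updateRow 0 c = Matrix.of (Matrix.vecCons c (Matrix.vecCons b r)) := by
      ext i j
      refine Fin.cases ?_ (fun i => ?_) i <;> simp [A, Matrix.updateRow_apply]
    have e1 : A.updateRow (Fin.succ 0) c = Matrix.of (Matrix.vecCons a (Matrix.vecCons c r)) := by
      ext i j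
      refine Fin.cases ?_ (fun i => Fin.cases ?_ (fun i => ?_) i) i <;>
        simp [A, Matrix.updateRow_apply, Fin.ext_iff]
    rw [e0, e1] at hlin
    have a0 : A 0 = a := by ext; simp [A]
    have a1 : A (Fin.succ 0) = b := by ext; simp [A]
    rw [a0, a1] at hlin
    simp only [hf] at hlin ⊢
    rw [hlin, hswap c b, hswap c a]
    ring
  · intro i _
    have : f (A (Fin.succ (Fin.succ i))) = 0 := by
      apply Matrix.det_zero_of_row_eq (i := 0) (j := i.succ.succ) (Fin.succ_ne_zero _).symm
      ext j
      simp [A]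
    rw [this, mul_zero]

section Hankel

variable (x w : ℕ → ℚ) (C : Finset ℕ)

/-- The product of differences of `x` over the values of `f`. -/
noncomputable def vandProd {k : ℕ} (f : Fin k → ℕ) : ℚ :=
  ∏ i, ∏ j ∈ Ioi i, (x (f j) - x (f i))

/-- The rows of weighted moments of `x` over `C`. -/
noncomputable def momentRows (m k : ℕ) (i : Fin k) (j : Fin m) : ℚ :=
  ∑ s ∈ C, (w s * x s ^ (Fin.rev i : ℕ)) * x s ^ (j : ℕ)

/-- The vector of degree `m - 1` monomials at a point of the projective line. -/
noncomputable def projVec (m : ℕ) (p : ℚ × ℚ) (j : Fin m) : ℚ :=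
  p.1 ^ (j : ℕ) * p.2 ^ (Fin.rev j : ℕ)

/-- The Hankel-type multiple sum with weight `w`. -/
noncomputable def hankelSum (k : ℕ) : ℚ :=
  ∑ f ∈ Fintype.piFinset (fun _ : Fin k => C), (∏ i, w (f i)) * vandProd x f ^ 2

lemma hankelSum_mul_left (k : ℕ) (c : ℚ) :
    hankelSum x (fun s => c * w s) C k = c ^ k * hankelSum x w C k := by
  simp [hankelSum, Finset.mul_sum, Finset.prod_mul_distrib, mul_assoc]

lemma hankelSum_congr {w w' : ℕ → ℚ} (k : ℕ) (h : ∀ s ∈ C, w s = w' s) :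
    hankelSum x w C k = hankelSum x w' C k := by
  refine Finset.sum_congr rfl fun f hf => ?_
  rw [Finset.prod_congr rfl fun i _ => h _ (Fintype.mem_piFinset.1 hf i)]

lemma vandProd_comp_perm {k : ℕ} (f : Fin k → ℕ) (σ : Equiv.Perm (Fin k)) :
    vandProd x (f ∘ σ) = (Equiv.Perm.sign σ : ℤ) * vandProd x f := by
  have h := Matrix.det_permute σ (Matrix.vandermonde fun i => x (f i))
  rw [Matrix.det_vandermonde] at h
  rw [vandProd, vandProd, ← h, ← Matrix.det_vandermonde]
  rfl

/-- Antisymmetrization of a sum of an alternating function against monomials. -/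
lemma factorial_mul_sum_monomial {k : ℕ} (G : (Fin k → ℕ) → ℚ)
    (hG : ∀ f (σ : Equiv.Perm (Fin k)), G (f ∘ σ) = (Equiv.Perm.sign σ : ℤ) * G f) :
    (k.factorial : ℚ) * ∑ f ∈ Fintype.piFinset (fun _ : Fin k => C),
        (∏ i, (w (f i) * x (f i) ^ (Fin.rev i : ℕ))) * G f =
      ∑ f ∈ Fintype.piFinset (fun _ : Fin k => C), (∏ i, w (f i)) *
        ((∏ i, ∏ j ∈ Ioi i, (x (f i) - x (f j))) * G f) := by
  have hd : ∀ f : Fin k → ℕ, (∏ i, ∏ j ∈ Ioi i, (x (f i) - x (f j))) =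
      ∑ σ : Equiv.Perm (Fin k), (Equiv.Perm.sign σ : ℤ) * ∏ i, x (f (σ i)) ^ (Fin.rev i : ℕ) := by
    intro f
    have h := Matrix.det_projVandermonde (fun _ : Fin k => (1 : ℚ)) (fun i => x (f i))
    simp only [one_mul] at h
    rw [← h, Matrix.det_apply]
    refine Finset.sum_congr rfl fun σ _ => ?_
    simp [Matrix.projVandermonde_apply, Units.smul_def]
  simp only [hd, Finset.sum_mul, Finset.mul_sum]
  rw [Finset.sum_comm]
  rw [← Finset.mul_sum]
  have : ∀ σ : Equiv.Perm (Fin k), ∑ f ∈ Fintype.piFinset (fun _ : Fin k => C),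
      (∏ i, w (f i)) * ((Equiv.Perm.sign σ : ℤ) * (∏ i, x (f (σ i)) ^ (Fin.rev i : ℕ)) * G f) =
      ∑ f ∈ Fintype.piFinset (fun _ : Fin k => C),
        (∏ i, (w (f i) * x (f i) ^ (Fin.rev i : ℕ))) * G f := by
    intro σ
    refine Finset.sum_bij' (fun f _ => f ∘ σ) (fun f _ => f ∘ σ.symm) ?_ ?_ ?_ ?_ ?_
    · intro f hf; simp only [Fintype.mem_piFinset] at hf ⊢; intro i; exact hf _
    · intro f hf; simp only [Fintype.mem_piFinset] at hf ⊢; intro i; exact hf _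
    · intro f _; ext; simp
    · intro f _; ext; simp
    · intro f _
      rw [hG, Finset.prod_mul_distrib]
      simp only [Function.comp_apply]
      rw [Equiv.prod_comp σ fun i => w (f i)]
      ring
  simp only [this, Finset.sum_const, Finset.card_univ, Fintype.card_perm, Fintype.card_fin,
    nsmul_eq_mul, Finset.mul_sum]

lemma sign_reversed_vandProd {k : ℕ} :
    ∃ ε : ℚ, ε ≠ 0 ∧ ∀ f : Fin k → ℕ,
      (∏ i, ∏ j ∈ Ioi i, (x (f i) - x (f j))) = ε * vandProd x f := by
  refine ⟨∏ i : Fin k, ∏ j ∈ Ioi i, (-1), ?_, fun f => ?_⟩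
  · simp [Finset.prod_ne_zero_iff]
  · rw [vandProd]
    simp only [← Finset.prod_mul_distrib]
    refine Finset.prod_congr rfl fun i _ => Finset.prod_congr rfl fun j _ => by ring

lemma det_cons_projVec {k : ℕ} (p : ℚ × ℚ) (f : Fin k → ℕ) :
    Matrix.det (Matrix.of (Matrix.vecCons (projVec (k + 1) p)
      (fun i => projVec (k + 1) (x (f i), 1)))) =
      (∏ i, (p.2 * x (f i) - p.1)) * vandProd x f := by
  have h := Matrix.det_projVandermonde (Matrix.vecCons p.1 fun i => x (f i))
    (Matrix.vecCons p.2 fun _ : Fin k => (1 : ℚ))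
  rw [Fin.prod_univ_succ] at h
  simp only [Fin.prod_Ioi_zero, Fin.prod_Ioi_succ, Matrix.cons_val_zero, Matrix.cons_val_succ,
    mul_one] at h
  rw [vandProd]
  convert h using 2
  · ext i j
    refine Fin.cases ?_ (fun i => ?_) i <;>
      simp [projVec, Matrix.projVandermonde_apply]
  · exact Finset.prod_congr rfl fun i _ => by ring

lemma det_cons_cons_projVec {k : ℕ} (p q : ℚ × ℚ) (f : Fin k → ℕ) :
    Matrix.det (Matrix.of (Matrix.vecCons (projVec (k + 2) p) (Matrix.vecCons (projVec (k + 2) q)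
      (fun i => projVec (k + 2) (x (f i), 1))))) =
      (q.1 * p.2 - p.1 * q.2) *
        ((∏ i, ((p.2 * x (f i) - p.1) * (q.2 * x (f i) - q.1))) * vandProd x f) := by
  have h := Matrix.det_projVandermonde (Matrix.vecCons p.1 (Matrix.vecCons q.1 fun i => x (f i)))
    (Matrix.vecCons p.2 (Matrix.vecCons q.2 fun _ : Fin k => (1 : ℚ)))
  rw [Fin.prod_univ_succ, Fin.prod_univ_succ] at h
  simp only [Fin.prod_Ioi_zero, Fin.prod_Ioi_succ, Matrix.cons_val_zero, Matrix.cons_val_succ,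
    mul_one, Fin.prod_univ_succ (n := k)] at h
  rw [vandProd]
  have e : (Matrix.of (Matrix.vecCons (projVec (k + 2) p) (Matrix.vecCons (projVec (k + 2) q)
      (fun i => projVec (k + 2) (x (f i), 1))))) = Matrix.projVandermonde
      (Matrix.vecCons p.1 (Matrix.vecCons q.1 fun i => x (f i)))
    (Matrix.vecCons p.2 (Matrix.vecCons q.2 fun _ : Fin k => (1 : ℚ))) := by
    ext i j
    refine Fin.cases ?_ (fun i => Fin.cases ?_ (fun i => ?_) i) i <;>
      simp [projVec, Matrix.projVandermonde_apply]
  rw [e, h, Finset.prod_mul_distrib, mul_assoc, mul_assoc]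
  congr 1
  congr 1
  · exact Finset.prod_congr rfl fun i _ => by ring
  · congr 1
    exact Finset.prod_congr rfl fun i _ => by ring

/-- Expansion of a multilinear function at the moment rows. -/
lemma map_momentRows {m k : ℕ} (Φ : MultilinearMap ℚ (fun _ : Fin k => Fin m → ℚ) ℚ) :
    Φ (momentRows x w C m k) = ∑ f ∈ Fintype.piFinset (fun _ : Fin k => C),
      (∏ i, (w (f i) * x (f i) ^ (Fin.rev i : ℕ))) * Φ (fun i => projVec m (x (f i), 1)) := by
  have e : momentRows x w C m k = fun i : Fin k =>
      ∑ s ∈ C, (w s * x s ^ (Fin.rev i : ℕ)) • projVec m (x s, 1) := by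
    ext i j
    simp [momentRows, projVec]
  rw [e, MultilinearMap.map_sum_finset]
  refine Finset.sum_congr rfl fun f _ => ?_
  rw [Φ.map_smul_univ (fun i => w (f i) * x (f i) ^ (Fin.rev i : ℕ)), smul_eq_mul]

lemma exists_det_cons_moment (k : ℕ) : ∃ κ : ℚ, κ ≠ 0 ∧ ∀ p : ℚ × ℚ,
    Matrix.det (Matrix.of (Matrix.vecCons (projVec (k + 1) p) (momentRows x w C (k + 1) k))) =
      κ * hankelSum x (fun s => (p.2 * x s - p.1) * w s) C k := by
  obtain ⟨ε, hε, hv⟩ := sign_reversed_vandProd x (k := k)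
  have hk : (k.factorial : ℚ) ≠ 0 := by exact_mod_cast k.factorial_ne_zero
  refine ⟨ε / k.factorial, div_ne_zero hε hk, fun p => ?_⟩
  rw [div_mul_eq_mul_div, eq_div_iff hk, mul_comm]
  have h := map_momentRows x w C (m := k + 1) (k := k)
    ((Matrix.detRowAlternating (n := Fin (k + 1)) (R := ℚ)).toMultilinearMap.curryLeft
      (projVec (k + 1) p))
  have e : ∀ r : Fin k → Fin (k + 1) → ℚ,
      ((Matrix.detRowAlternating (n := Fin (k + 1)) (R := ℚ)).toMultilinearMap.curryLeft
      (projVec (k + 1) p)) r = Matrix.det (Matrix.of (Matrix.vecCons (projVec (k + 1) p) r)) :=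
    fun r => rfl
  simp only [e, det_cons_projVec] at h
  rw [h, factorial_mul_sum_monomial, hankelSum, Finset.mul_sum]
  · refine Finset.sum_congr rfl fun f _ => ?_
    rw [hv, Finset.prod_mul_distrib]
    ring
  · intro f σ
    rw [vandProd_comp_perm]
    simp only [Function.comp_apply]
    rw [Equiv.prod_comp σ fun i => p.2 * x (f i) - p.1]
    ring

lemma exists_det_cons_cons_moment (k : ℕ) : ∃ κ : ℚ, κ ≠ 0 ∧ ∀ p q : ℚ × ℚ,
    Matrix.det (Matrix.of (Matrix.vecCons (projVec (k + 2) p)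
      (Matrix.vecCons (projVec (k + 2) q) (momentRows x w C (k + 2) k)))) =
      κ * ((q.1 * p.2 - p.1 * q.2) *
        hankelSum x (fun s => (p.2 * x s - p.1) * (q.2 * x s - q.1) * w s) C k) := by
  obtain ⟨ε, hε, hv⟩ := sign_reversed_vandProd x (k := k)
  have hk : (k.factorial : ℚ) ≠ 0 := by exact_mod_cast k.factorial_ne_zero
  refine ⟨ε / k.factorial, div_ne_zero hε hk, fun p q => ?_⟩
  rw [div_mul_eq_mul_div, eq_div_iff hk, mul_comm]
  have h := map_momentRows x w C (m := k + 2) (k := k)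
    (((Matrix.detRowAlternating (n := Fin (k + 2)) (R := ℚ)).toMultilinearMap.curryLeft
      (projVec (k + 2) p)).curryLeft (projVec (k + 2) q))
  have e : ∀ r : Fin k → Fin (k + 2) → ℚ,
      (((Matrix.detRowAlternating (n := Fin (k + 2)) (R := ℚ)).toMultilinearMap.curryLeft
      (projVec (k + 2) p)).curryLeft (projVec (k + 2) q)) r =
      Matrix.det (Matrix.of (Matrix.vecCons (projVec (k + 2) p)
        (Matrix.vecCons (projVec (k + 2) q) r))) :=
    fun r => rfl
  simp only [e, det_cons_cons_projVec] at h
  rw [h, factorial_mul_sum_monomial, hankelSum, Finset.mul_sum, Finset.mul_sum]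
  · refine Finset.sum_congr rfl fun f _ => ?_
    rw [hv, Finset.prod_mul_distrib (f := fun i => (p.2 * x (f i) - p.1) * (q.2 * x (f i) - q.1))]
    ring
  · intro f σ
    rw [vandProd_comp_perm]
    simp only [Function.comp_apply]
    rw [Equiv.prod_comp σ fun i => (p.2 * x (f i) - p.1) * (q.2 * x (f i) - q.1)]
    ring

lemma momentRows_succ (m k : ℕ) : momentRows x w C m (k + 1) =
    Matrix.vecCons (momentRows x w C m (k + 1) 0) (momentRows x w C m k) := by
  ext i j
  refine Fin.cases ?_ (fun i => ?_) i
  · simp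
  · simp [momentRows, Fin.val_rev]

/-- The condensation relation for Hankel-type sums. -/
lemma hankelSum_condensation (k : ℕ) (a b : ℚ) :
    (b - a) * hankelSum x (fun s => (x s - a) * (b - x s) * w s) C k *
        hankelSum x w C (k + 1) =
      hankelSum x (fun s => (b - x s) * w s) C (k + 1) *
        hankelSum x (fun s => (x s - a) * w s) C k +
      hankelSum x (fun s => (x s - a) * w s) C (k + 1) *
        hankelSum x (fun s => (b - x s) * w s) C k := by
  obtain ⟨κ, hκ, h1⟩ := exists_det_cons_moment x w C (k + 1)
  obtain ⟨μ, hμ, h2⟩ := exists_det_cons_cons_moment x w C k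
  have h := det_plucker (momentRows x w C (k + 2) k) (projVec (k + 2) (a, 1))
    (projVec (k + 2) (b, 1)) (projVec (k + 2) (1, 0)) (momentRows x w C (k + 2) (k + 1) 0)
  simp only [← momentRows_succ, h1, h2] at h
  have e0 : ∀ m, hankelSum x (fun s => (0 * x s - 1) * w s) C m =
      (-1) ^ m * hankelSum x w C m := by
    intro m
    rw [← hankelSum_mul_left]
    exact hankelSum_congr _ _ _ fun s _ => by ring
  have e1 : ∀ m, hankelSum x (fun s => (1 * x s - b) * w s) C m =
      (-1) ^ m * hankelSum x (fun s => (b - x s) * w s) C m := by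
    intro m
    rw [← hankelSum_mul_left]
    exact hankelSum_congr _ _ _ fun s _ => by ring
  have e2 : ∀ m, hankelSum x (fun s => (1 * x s - a) * (1 * x s - b) * w s) C m =
      (-1) ^ m * hankelSum x (fun s => (x s - a) * (b - x s) * w s) C m := by
    intro m
    rw [← hankelSum_mul_left]
    exact hankelSum_congr _ _ _ fun s _ => by ring
  have e3 : ∀ m, hankelSum x (fun s => (1 * x s - a) * w s) C m =
      hankelSum x (fun s => (x s - a) * w s) C m := by
    intro m
    exact hankelSum_congr _ _ _ fun s _ => by ring
  have e4 : ∀ m, hankelSum x (fun s => (1 * x s - b) * (0 * x s - 1) * w s) C m =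
      hankelSum x (fun s => (b - x s) * w s) C m := by
    intro m
    exact hankelSum_congr _ _ _ fun s _ => by ring
  have e5 : ∀ m, hankelSum x (fun s => (0 * x s - 1) * (1 * x s - a) * w s) C m =
      (-1) ^ m * hankelSum x (fun s => (x s - a) * w s) C m := by
    intro m
    rw [← hankelSum_mul_left]
    exact hankelSum_congr _ _ _ fun s _ => by ring
  rw [e0, e1, e2, e3, e4, e5] at h
  have hs : ((-1 : ℚ) ^ k) * (-1) ^ k = 1 := by rw [← mul_pow]; simp
  have hne : κ * μ ≠ 0 := mul_ne_zero hκ hμ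
  apply mul_left_cancel₀ hne
  rw [pow_succ] at h
  linear_combination (-1 : ℚ) * h - (κ * μ * ((b - a) *
    hankelSum x (fun s => (x s - a) * (b - x s) * w s) C k *
        hankelSum x w C (k + 1) - hankelSum x (fun s => (b - x s) * w s) C (k + 1) *
        hankelSum x (fun s => (x s - a) * w s) C k)) * hs

end Hankel

section DentSum

variable (x : ℕ → ℚ)

/-- The product of the absolute differences of `x` over pairs in `A`. -/
noncomputable def vandSet (A : Finset ℕ) : ℚ :=
  ∏ p ∈ A, ∏ q ∈ A with p < q, |x q - x p|

lemma vandSet_insert {a : ℕ} {A : Finset ℕ} (ha : a ∉ A) :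
    vandSet x (insert a A) = vandSet x A * ∏ p ∈ A, |x a - x p| := by
  have h1 : ∀ p ∈ A, ∏ q ∈ insert a A with p < q, |x q - x p| =
      (∏ q ∈ A with p < q, |x q - x p|) * if p < a then |x a - x p| else 1 := by
    intro p _
    rw [Finset.filter_insert]
    split_ifs with h
    · rw [Finset.prod_insert (by simp [ha]), mul_comm]
    · rw [mul_one]
  have h2 : ∏ q ∈ insert a A with a < q, |x q - x a| =
      ∏ p ∈ A, if p < a then 1 else |x a - x p| := by
    rw [Finset.filter_insert, if_neg (lt_irrefl _), Finset.prod_filter]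
    refine Finset.prod_congr rfl fun q hq => ?_
    have : q ≠ a := fun h => ha (h ▸ hq)
    rcases lt_or_gt_of_ne this with h | h
    · rw [if_neg h.le.not_gt, if_pos h]
    · rw [if_pos h, if_neg h.le.not_gt, abs_sub_comm]
  rw [vandSet, Finset.prod_insert ha, h2, Finset.prod_congr rfl h1, Finset.prod_mul_distrib,
    mul_left_comm, ← Finset.prod_mul_distrib, vandSet]
  congr 1
  exact Finset.prod_congr rfl fun p _ => by split_ifs <;> simp

lemma vandSet_union {A S : Finset ℕ} (h : Disjoint A S) :
    vandSet x (A ∪ S) = vandSet x A * vandSet x S * ∏ s ∈ S, ∏ a ∈ A, |x a - x s| := by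
  induction S using Finset.induction_on with
  | empty => simp [vandSet]
  | insert s S hs ih =>
    rw [Finset.disjoint_insert_right] at h
    rw [Finset.union_insert, vandSet_insert x (by simp [hs, h.1]), ih h.2, vandSet_insert x hs,
      Finset.prod_union h.2, Finset.prod_insert hs]
    simp only [abs_sub_comm (x s)]
    ring

lemma vandSet_image {k : ℕ} (f : Fin k → ℕ) (hf : Function.Injective f) :
    vandSet x (univ.image f) = |vandProd x f| := by
  induction k with
  | zero => simp [vandSet, vandProd]
  | succ k ih =>
    have e : univ.image f = insert (f 0) (univ.image fun i : Fin k => f i.succ) := by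
      ext a; simp [Fin.exists_fin_succ, eq_comm]
    have hinj : Function.Injective fun i : Fin k => f i.succ :=
      hf.comp (Fin.succ_injective k)
    rw [e, vandSet_insert, ih _ hinj, Finset.prod_image hinj.injOn, vandProd, vandProd,
      Fin.prod_univ_succ]
    · simp only [Fin.prod_Ioi_zero, Fin.prod_Ioi_succ, abs_mul, Finset.abs_prod]
      rw [mul_comm]
      simp only [abs_sub_comm]
    · simp only [Finset.mem_image, not_exists, not_and, mem_univ, true_imp_iff]
      intro i hi
      exact Fin.succ_ne_zero i (hf hi)

lemma vandProd_eq_zero {k : ℕ} (f : Fin k → ℕ) (hf : ¬ Function.Injective f) :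
    vandProd x f = 0 := by
  rw [vandProd, ← Matrix.det_vandermonde fun i => x (f i)]
  simp only [Function.Injective, not_forall] at hf
  obtain ⟨i, j, hij, hne⟩ := hf
  exact Matrix.det_zero_of_row_eq hne (by ext; simp [Matrix.vandermonde_apply, hij])

/-- A sum over functions supported on injective ones is a sum over subsets. -/
lemma sum_piFinset_eq_factorial_mul {k : ℕ} (C : Finset ℕ) (g : (Fin k → ℕ) → ℚ)
    (h : Finset ℕ → ℚ) (h0 : ∀ f, ¬ Function.Injective f → g f = 0)
    (h1 : ∀ f, Function.Injective f → g f = h (univ.image f)) :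
    ∑ f ∈ Fintype.piFinset (fun _ : Fin k => C), g f =
      k.factorial * ∑ S ∈ C.powersetCard k, h S := by
  classical
  rw [← Finset.sum_filter_of_ne (p := Function.Injective)
    (fun f _ hne => by by_contra hc; exact hne (h0 f hc))]
  rw [← Finset.sum_fiberwise_of_maps_to (t := C.powersetCard k) (g := fun f => univ.image f)]
  · rw [Finset.mul_sum]
    refine Finset.sum_congr rfl fun S hS => ?_
    rw [Finset.mem_powersetCard] at hS
    rw [Finset.sum_congr rfl (g := fun _ => h S)]
    · rw [Finset.sum_const, nsmul_eq_mul]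
      congr 2
      rw [← Fintype.card_fin k, ← Fintype.card_perm, Fintype.card_fin, ← Finset.card_univ]
      symm
      refine Finset.card_bij (fun σ _ => fun j => S.orderEmbOfFin hS.2 (σ j)) ?_ ?_ ?_
      · intro σ _
        simp only [Finset.mem_filter, Fintype.mem_piFinset]
        refine ⟨⟨fun i => hS.1 (Finset.orderEmbOfFin_mem _ _ _),
          (S.orderEmbOfFin hS.2).injective.comp σ.injective⟩, ?_⟩
        rw [← Finset.coe_inj, Finset.coe_image, Finset.coe_univ, Set.image_univ]
        rw [← Finset.range_orderEmbOfFin S hS.2]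
        exact σ.surjective.range_comp _
      · intro σ _ τ _ e
        ext j
        rw [(S.orderEmbOfFin hS.2).injective (congrFun e j)]
      · intro f hf
        simp only [Finset.mem_filter] at hf
        have hm : ∀ j, f j ∈ S := fun j => hf.2 ▸ Finset.mem_image_of_mem f (mem_univ j)
        let φ : Fin k → Fin k := fun j => (S.orderIsoOfFin hS.2).symm ⟨f j, hm j⟩
        have hφ : Function.Injective φ := by
          intro i j hij
          have := (S.orderIsoOfFin hS.2).symm.injective hij
          exact hf.1.2 (congrArg Subtype.val this)
        refine ⟨Equiv.ofBijective φ (Finite.injective_iff_bijective.1 hφ), mem_univ _, ?_⟩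
        ext j
        simp [φ, ← Finset.coe_orderIsoOfFin_apply]
    · intro f hf
      simp only [Finset.mem_filter] at hf
      rw [h1 f hf.1.2, hf.2]
  · intro f hf
    simp only [Finset.mem_filter, Fintype.mem_piFinset] at hf
    rw [Finset.mem_powersetCard]
    refine ⟨?_, by rw [Finset.card_image_of_injective _ hf.2]; simp⟩
    intro a ha
    obtain ⟨i, _, rfl⟩ := Finset.mem_image.1 ha
    exact hf.1 i

/-- The sum of products of Vandermonde products with common extra points from `C`. -/
noncomputable def dentSum (y : ℕ) (U D C : Finset ℕ) : ℚ :=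
  ∑ S ∈ C.powersetCard y, vandSet x (U ∪ S) * vandSet x (D ∪ S)

/-- The weight by which the points of `U` and `D` enter `dentSum`. -/
noncomputable def dentWeight (U D : Finset ℕ) (s : ℕ) : ℚ :=
  (∏ a ∈ U, |x a - x s|) * ∏ a ∈ D, |x a - x s|

lemma dentSum_eq (y : ℕ) {U D C : Finset ℕ} (hU : Disjoint U C) (hD : Disjoint D C) :
    dentSum x y U D C * y.factorial =
      vandSet x U * vandSet x D * hankelSum x (dentWeight x U D) C y := by
  rw [hankelSum, sum_piFinset_eq_factorial_mul C _
    (fun S => (∏ s ∈ S, dentWeight x U D s) * vandSet x S ^ 2)]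
  · rw [dentSum, mul_comm, mul_left_comm, Finset.mul_sum (s := C.powersetCard y) (f := fun S => _ * _ ^ 2)]
    congr 1
    refine Finset.sum_congr rfl fun S hS => ?_
    have hS := (Finset.mem_powersetCard.1 hS).1
    rw [vandSet_union x (hU.mono_right hS), vandSet_union x (hD.mono_right hS)]
    simp only [dentWeight, Finset.prod_mul_distrib]
    ring
  · intro f hf
    rw [vandProd_eq_zero x f hf]; simp
  · intro f hf
    rw [vandSet_image x f hf, sq_abs, Finset.prod_image hf.injOn]

lemma hankelSum_erase (w : ℕ → ℚ) {C : Finset ℕ} (y : ℕ) {C' : Finset ℕ} (hC : C' ⊆ C)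
    (h : ∀ s ∈ C, s ∉ C' → w s = 0) : hankelSum x w C' y = hankelSum x w C y := by
  refine Finset.sum_subset (Fintype.piFinset_subset _ _ fun _ => hC) fun f hf hf' => ?_
  simp only [Fintype.mem_piFinset, not_forall] at hf hf'
  obtain ⟨i, hi⟩ := hf'
  rw [Finset.prod_eq_zero (mem_univ i) (h _ (hf i) hi), zero_mul]

/-- The condensation relation for `dentSum`. -/
lemma dentSum_condensation (y : ℕ) {U D C : Finset ℕ} {α β : ℕ}
    (hU : Disjoint U C) (hD : Disjoint D C) (hα : α ∈ C) (hβ : β ∈ C) (hne : α ≠ β)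
    (hmin : ∀ s ∈ C, x α ≤ x s) (hmax : ∀ s ∈ C, x s ≤ x β) :
    dentSum x (y + 1) U D C *
        dentSum x y (insert α (insert β U)) D ((C.erase α).erase β) =
      dentSum x (y + 1) (insert β U) D (C.erase β) * dentSum x y (insert α U) D (C.erase α) +
      dentSum x (y + 1) (insert α U) D (C.erase α) * dentSum x y (insert β U) D (C.erase β) := by
  have hαU : α ∉ U := fun h => Finset.disjoint_left.1 hU h hα
  have hβU : β ∉ U := fun h => Finset.disjoint_left.1 hU h hβ
  set w := dentWeight x U D with hw
  have hwa : ∀ m, hankelSum x (dentWeight x (insert α U) D) (C.erase α) m =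
      hankelSum x (fun s => (x s - x α) * w s) C m := by
    intro m
    rw [← hankelSum_erase x _ m (Finset.erase_subset α C)]
    · refine hankelSum_congr x _ m fun s hs => ?_
      have := hmin s (Finset.mem_of_mem_erase hs)
      rw [hw, dentWeight, dentWeight, Finset.prod_insert hαU, abs_sub_comm,
        abs_of_nonneg (sub_nonneg.2 this), mul_assoc]
    · intro s hs hs'
      simp only [Finset.mem_erase, hs, and_true, not_not] at hs'
      simp [hs']
  have hwb : ∀ m, hankelSum x (dentWeight x (insert β U) D) (C.erase β) m =
      hankelSum x (fun s => (x β - x s) * w s) C m := by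
    intro m
    rw [← hankelSum_erase x _ m (Finset.erase_subset β C)]
    · refine hankelSum_congr x _ m fun s hs => ?_
      have := hmax s (Finset.mem_of_mem_erase hs)
      rw [hw, dentWeight, dentWeight, Finset.prod_insert hβU,
        abs_of_nonneg (sub_nonneg.2 this), mul_assoc]
    · intro s hs hs'
      simp only [Finset.mem_erase, hs, and_true, not_not] at hs'
      simp [hs']
  have hwab : ∀ m, hankelSum x (dentWeight x (insert α (insert β U)) D) ((C.erase α).erase β) m =
      hankelSum x (fun s => (x s - x α) * (x β - x s) * w s) C m := by
    intro m
    rw [← hankelSum_erase x _ m ((Finset.erase_subset β _).trans (Finset.erase_subset α C))]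
    · refine hankelSum_congr x _ m fun s hs => ?_
      have hs := Finset.mem_of_mem_erase (Finset.mem_of_mem_erase hs)
      rw [hw, dentWeight, dentWeight, Finset.prod_insert (by simp [hαU, hne]),
        Finset.prod_insert hβU, abs_sub_comm, abs_of_nonneg (sub_nonneg.2 (hmin s hs)),
        abs_of_nonneg (sub_nonneg.2 (hmax s hs))]
      ring
    · intro s hs hs'
      simp only [Finset.mem_erase, hs, and_true] at hs'
      by_cases h : s = α
      · simp [h]
      · have : s = β := by tauto
        simp [this]
  have dis : ∀ {a : ℕ}, Disjoint (insert a U) (C.erase a) := fun {a} => by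
    rw [Finset.disjoint_insert_left]
    exact ⟨by simp, hU.mono_right (Finset.erase_subset _ _)⟩
  have dab : Disjoint (insert α (insert β U)) ((C.erase α).erase β) := by
    rw [Finset.disjoint_insert_left, Finset.disjoint_insert_left]
    exact ⟨by simp, by simp, hU.mono_right
      ((Finset.erase_subset β _).trans (Finset.erase_subset α C))⟩
  have dD : ∀ {a : ℕ}, Disjoint D (C.erase a) := fun {a} => hD.mono_right (Finset.erase_subset _ _)
  have dDab : Disjoint D ((C.erase α).erase β) := dD.mono_right (Finset.erase_subset _ _)
  have q0 := dentSum_eq x (y + 1) hU hD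
  have qab := dentSum_eq x y dab dDab
  have qb1 := dentSum_eq x (y + 1) (dis (a := β)) dD
  have qa1 := dentSum_eq x (y + 1) (dis (a := α)) dD
  have qb := dentSum_eq x y (dis (a := β)) dD
  have qa := dentSum_eq x y (dis (a := α)) dD
  rw [hwab, vandSet_insert x (by simp [hαU, hne]), vandSet_insert x hβU,
    Finset.prod_insert hβU, abs_sub_comm (x α), abs_of_nonneg (sub_nonneg.2 (hmin β hβ))] at qab
  rw [hwa, vandSet_insert x hαU] at qa qa1
  rw [hwb, vandSet_insert x hβU] at qb qb1
  have key := hankelSum_condensation x w C y (x α) (x β)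
  have f0 : (y.factorial : ℚ) ≠ 0 := by exact_mod_cast y.factorial_ne_zero
  have f1 : ((y + 1).factorial : ℚ) ≠ 0 := by exact_mod_cast (y + 1).factorial_ne_zero
  apply mul_left_cancel₀ (mul_ne_zero f0 f1)
  set PA := ∏ p ∈ U, |x α - x p|
  set PB := ∏ p ∈ U, |x β - x p|
  calc _ = (dentSum x (y + 1) U D C * (y + 1).factorial) *
        (dentSum x y (insert α (insert β U)) D ((C.erase α).erase β) * y.factorial) := by ring
    _ = (dentSum x (y + 1) (insert β U) D (C.erase β) * (y + 1).factorial) *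
        (dentSum x y (insert α U) D (C.erase α) * y.factorial) +
        (dentSum x (y + 1) (insert α U) D (C.erase α) * (y + 1).factorial) *
        (dentSum x y (insert β U) D (C.erase β) * y.factorial) := by
      rw [q0, qab, qb1, qa1, qb, qa]
      linear_combination (vandSet x U ^ 2 * vandSet x D ^ 2 * PA * PB) * key
    _ = _ := by ring

end DentSum

section ChooseDet

/-- The matrix of even central-type binomial coefficients. -/
noncomputable def evenDet {k : ℕ} (a : Fin k → ℕ) : ℚ :=
  Matrix.det (Matrix.of fun j r : Fin k => (((a j + r).choose (2 * r) : ℕ) : ℚ))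

/-- The matrix of odd central-type binomial coefficients. -/
noncomputable def oddDet {k : ℕ} (a : Fin k → ℕ) : ℚ :=
  Matrix.det (Matrix.of fun j r : Fin k => (((a j + r + 1).choose (2 * r + 1) : ℕ) : ℚ))

lemma sum_range_choose_even (n r : ℕ) :
    ∑ c ∈ range n, (((c + r).choose (2 * r) : ℕ) : ℚ) = ((n + r).choose (2 * r + 1) : ℕ) := by
  induction n with
  | zero => rw [Nat.choose_eq_zero_of_lt (by omega)]; simp
  | succ n ih =>
    rw [Finset.sum_range_succ, ih, show n + 1 + r = (n + r) + 1 by ring, Nat.choose_succ_succ]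
    push_cast; ring

lemma sum_range_choose_odd (n r : ℕ) :
    ∑ c ∈ range n, (((c + r + 1).choose (2 * r + 1) : ℕ) : ℚ) =
      ((n + r + 1).choose (2 * r + 2) : ℕ) := by
  induction n with
  | zero => rw [Nat.choose_eq_zero_of_lt (by omega)]; simp
  | succ n ih =>
    rw [Finset.sum_range_succ, ih, show n + 1 + r + 1 = (n + r + 1) + 1 by ring,
      Nat.choose_succ_succ (n + r + 1) (2 * r + 1)]
    push_cast; exact add_comm _ _

lemma sum_piFinset_det {k : ℕ} (I : Fin k → Finset ℕ) (φ : ℕ → Fin k → ℚ) :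
    ∑ b ∈ Fintype.piFinset I, Matrix.det (Matrix.of fun j => φ (b j)) =
      Matrix.det (Matrix.of fun j r => ∑ c ∈ I j, φ c r) := by
  have h := ((Matrix.detRowAlternating (n := Fin k) (R := ℚ)).toMultilinearMap).map_sum_finset
    (fun _ c => φ c) I
  rw [show (Matrix.of fun j r => ∑ c ∈ I j, φ c r) = Matrix.of fun j => ∑ c ∈ I j, φ c by
    ext j r; simp]
  exact h.symm

lemma sum_oddDet {k : ℕ} (a : Fin (k + 1) → ℕ) (ha : Monotone a) :
    ∑ b ∈ Fintype.piFinset (fun j : Fin k => Ico (a j.castSucc) (a j.succ)), oddDet b =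
      evenDet a := by
  unfold oddDet evenDet
  rw [sum_piFinset_det (fun j : Fin k => Ico (a j.castSucc) (a j.succ))
    (fun c r => (((c + r + 1).choose (2 * r + 1) : ℕ) : ℚ))]
  rw [Matrix.det_eq_of_forall_row_eq_smul_add_pred (B := Matrix.of (Matrix.vecCons
    (fun r : Fin (k + 1) => (((a 0 + r).choose (2 * r) : ℕ) : ℚ))
    fun j r => (((a j.succ + r).choose (2 * r) : ℕ) : ℚ) -
      (((a j.castSucc + r).choose (2 * r) : ℕ) : ℚ))) (fun _ => 1)]
  · rw [Matrix.det_succ_column_zero, Fin.sum_univ_succ, Finset.sum_eq_zero]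
    · simp only [Fin.val_zero, pow_zero, one_mul, Matrix.of_apply, Matrix.cons_val_zero, add_zero,
        mul_zero, Nat.choose_zero_right, Nat.cast_one, Fin.succAbove_zero]
      congr 1
      ext j r
      simp only [Matrix.of_apply, Matrix.submatrix_apply, Matrix.cons_val_succ, Fin.val_succ]
      rw [Finset.sum_Ico_eq_sub _ (ha (Fin.castSucc_lt_succ).le), sum_range_choose_odd,
        sum_range_choose_odd]
      simp only [mul_add, add_assoc, mul_one]
    · intro i _
      simp
  · intro j; simp
  · intro i j; simp

lemma sum_evenDet {k : ℕ} (b : Fin (k + 1) → ℕ) (hb : Monotone b) :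
    ∑ c ∈ Fintype.piFinset (fun j : Fin (k + 1) =>
      Ico ((Matrix.vecCons 0 fun i : Fin k => b i.castSucc + 1) j) (b j + 1)), evenDet c =
      oddDet b := by
  unfold oddDet evenDet
  rw [sum_piFinset_det (fun j : Fin (k + 1) =>
      Ico ((Matrix.vecCons 0 fun i : Fin k => b i.castSucc + 1) j) (b j + 1))
    (fun c r => (((c + r).choose (2 * r) : ℕ) : ℚ))]
  symm
  apply Matrix.det_eq_of_forall_row_eq_smul_add_pred (fun _ => 1)
  · intro j
    simp only [Matrix.of_apply, Matrix.cons_val_zero, Nat.Ico_zero_eq_range,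
      sum_range_choose_even]
    congr 2; ring
  · intro i j
    simp only [Matrix.of_apply, Matrix.cons_val_succ]
    rw [Finset.sum_Ico_eq_sub _ (Nat.succ_le_succ (hb (Fin.castSucc_lt_succ).le)),
      sum_range_choose_even, sum_range_choose_even, add_right_comm (b i.succ),
      add_right_comm (b i.castSucc)]
    ring

lemma prod_eq_choose (a r : ℕ) :
    ∏ l ∈ range r, ((a : ℚ) * (a + 1) - l * (l + 1)) =
      (2 * r).factorial * ((a + r).choose (2 * r) : ℕ) := by
  have h : ∏ l ∈ range r, ((a : ℚ) * (a + 1) - l * (l + 1)) =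
      ((a + r).descFactorial (2 * r) : ℕ) := by
    induction r with
    | zero => simp
    | succ r ih =>
      rw [Finset.prod_range_succ, ih, show a + (r + 1) = (a + r) + 1 by ring,
        show 2 * (r + 1) = 2 * r + 1 + 1 by ring, Nat.succ_descFactorial_succ,
        Nat.descFactorial_succ]
      rcases lt_or_ge a r with h | h
      · rw [Nat.descFactorial_eq_zero_iff_lt.2 (by omega : a + r < 2 * r)]; simp
      · rw [show a + r - 2 * r = a - r by omega]
        push_cast [Nat.cast_sub h]
        ring
  rw [h, Nat.descFactorial_eq_factorial_mul_choose]
  push_cast; ring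

lemma evenDet_eq {k : ℕ} (a : Fin k → ℕ) :
    evenDet a = (∏ r : Fin k, ((2 * (r : ℕ)).factorial : ℚ))⁻¹ *
      ∏ i, ∏ j ∈ Ioi i, ((a j : ℚ) * (a j + 1) - a i * (a i + 1)) := by
  rw [← Matrix.det_vandermonde (fun j => (a j : ℚ) * (a j + 1)),
    Matrix.det_eval_matrixOfPolynomials_eq_det_vandermonde _
      (fun r : Fin k => ∏ l ∈ range r, (Polynomial.X - Polynomial.C ((l : ℚ) * (l + 1))))]
  · rw [eq_inv_mul_iff_mul_eq₀ (Finset.prod_ne_zero_iff.2 fun r _ => by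
      exact_mod_cast Nat.factorial_ne_zero _), evenDet, ← Matrix.det_mul_row]
    congr 1
    ext j r
    simp only [Matrix.of_apply, Polynomial.eval_prod, Polynomial.eval_sub, Polynomial.eval_X,
      Polynomial.eval_C]
    rw [prod_eq_choose]
  · intro i
    rw [Polynomial.natDegree_prod_of_monic _ _ fun l _ => Polynomial.monic_X_sub_C _]
    simp only [Polynomial.natDegree_X_sub_C, Finset.sum_const, Finset.card_range, smul_eq_mul,
      mul_one]
  · intro i
    exact Polynomial.monic_prod_of_monic _ _ fun l _ => Polynomial.monic_X_sub_C _

end ChooseDet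

section PathMatching

/-- A perfect matching of the path with vertices `x 0, y 0, x 1, y 1, …` restricted to the
vertices selected by `X` and `Y`: `L i` says that `x i, y i` are matched and `R i` says that
`y i, x (i + 1)` are matched. -/
structure IsPathMatching (X Y L R : ℕ → Prop) : Prop where
  right_iff : ∀ i, Y i ↔ L i ∨ R i
  right_excl : ∀ i, ¬ (L i ∧ R i)
  zero_iff : X 0 ↔ L 0
  succ_iff : ∀ i, X (i + 1) ↔ L (i + 1) ∨ R i
  succ_excl : ∀ i, ¬ (L (i + 1) ∧ R i)

lemma IsPathMatching.unique {X Y L R L' R' : ℕ → Prop} (h : IsPathMatching X Y L R)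
    (h' : IsPathMatching X Y L' R') (i : ℕ) : (L i ↔ L' i) ∧ (R i ↔ R' i) := by
  induction i with
  | zero =>
    have := h.zero_iff; have := h'.zero_iff; have := h.right_iff 0; have := h'.right_iff 0
    have := h.right_excl 0; have := h'.right_excl 0
    tauto
  | succ i ih =>
    have := h.succ_iff i; have := h'.succ_iff i
    have := h.succ_excl i; have := h'.succ_excl i
    have := h.right_iff (i + 1); have := h'.right_iff (i + 1)
    have := h.right_excl (i + 1); have := h'.right_excl (i + 1)
    grind

open Classical in
lemma IsPathMatching.card_eq {X Y L R : ℕ → Prop} (h : IsPathMatching X Y L R) (n : ℕ) :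
    #{i ∈ range (n + 1) | ¬ Y i} + (if R n then 1 else 0) = #{i ∈ range (n + 1) | ¬ X i} := by
  induction n with
  | zero =>
    have := h.zero_iff; have := h.right_iff 0; have := h.right_excl 0
    simp only [zero_add, Finset.range_one, Finset.filter_singleton]
    by_cases h1 : L 0 <;> by_cases h2 : R 0 <;> simp_all
  | succ n ih =>
    have h1 := h.succ_iff n; have h2 := h.succ_excl n; have h3 := h.right_iff (n + 1)
    have h4 := h.right_excl (n + 1)
    rw [Finset.range_add_one, Finset.filter_insert, Finset.filter_insert]
    by_cases c1 : L (n + 1) <;> by_cases c2 : R n <;> by_cases c3 : R (n + 1) <;>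
      simp_all [Finset.card_insert_of_notMem]

/-- Rank characterization for increasing enumerations. -/
lemma lt_card_filter_iff {k : ℕ} {a : Fin k → ℕ} (ha : StrictMono a) (n : ℕ) (j : Fin k) :
    (j : ℕ) < #{i ∈ range n | i ∈ univ.image a} ↔ a j < n := by
  have e : {i ∈ range n | i ∈ univ.image a} = (univ.filter fun i => a i < n).image a := by
    ext i
    simp only [Finset.mem_filter, Finset.mem_range, Finset.mem_image, mem_univ, true_and]
    constructor
    · rintro ⟨h, i, rfl⟩; exact ⟨i, h, rfl⟩
    · rintro ⟨i, h, rfl⟩; exact ⟨h, i, rfl⟩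
  rw [e, Finset.card_image_of_injective _ ha.injective]
  constructor
  · intro h
    by_contra hc
    have : (univ.filter fun i => a i < n) ⊆ Finset.Iio j := by
      intro i hi
      simp only [Finset.mem_filter, mem_univ, true_and] at hi
      rw [Finset.mem_Iio]
      exact ha.lt_iff_lt.1 (by omega)
    have := Finset.card_le_card this
    rw [Fin.card_Iio] at this
    omega
  · intro h
    have : Finset.Iic j ⊆ (univ.filter fun i => a i < n) := by
      intro i hi
      simp only [Finset.mem_filter, mem_univ, true_and]
      exact (ha.monotone (Finset.mem_Iic.1 hi)).trans_lt h
    have := Finset.card_le_card this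
    rw [Fin.card_Iic] at this
    omega

/-- Indicator that the path of width `W` with `A` and `B` deleted has a perfect matching. -/
def HasPathMatching (W : ℕ) (A B : Finset ℕ) : Prop :=
  ∃ L R, IsPathMatching (fun i => i < W ∧ i ∉ A) (fun i => i < W ∧ i ∉ B) L R

lemma card_filter_eq_of_isPathMatching {W : ℕ} {A B : Finset ℕ} {L R : ℕ → Prop}
    (h : IsPathMatching (fun i => i < W ∧ i ∉ A) (fun i => i < W ∧ i ∉ B) L R) {n : ℕ}
    (hn : n ≤ W) (hR : ∀ m, n = m + 1 → ¬ R m) :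
    #{i ∈ range n | i ∈ A} = #{i ∈ range n | i ∈ B} := by
  classical
  cases n with
  | zero => simp
  | succ m =>
    have := h.card_eq m
    rw [if_neg (hR m rfl), add_zero] at this
    have e : ∀ S : Finset ℕ,
        {i ∈ range (m + 1) | ¬ (i < W ∧ i ∉ S)} = {i ∈ range (m + 1) | i ∈ S} := by
      intro S
      apply Finset.filter_congr
      intro i hi
      have := Finset.mem_range.1 hi
      have : i < W := by omega
      simp [this]
    have e1 := e A
    have e2 := e B
    rw [← e1, ← e2]
    convert this.symm using 2 <;> · ext i; simp only [Finset.mem_filter]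

lemma HasPathMatching.card_eq {W : ℕ} {A B : Finset ℕ} (h : HasPathMatching W A B)
    (hA : A ⊆ range W) (hB : B ⊆ range W) : #A = #B := by
  obtain ⟨L, R, h⟩ := h
  have := card_filter_eq_of_isPathMatching h le_rfl (by
    rintro m rfl hm
    have := (h.succ_iff m).2 (Or.inr hm)
    omega)
  rwa [Finset.filter_mem_eq_inter, Finset.filter_mem_eq_inter, Finset.inter_eq_right.2 hA,
    Finset.inter_eq_right.2 hB] at this

lemma hasPathMatching_iff {W k : ℕ} {a b : Fin k → ℕ} (ha : StrictMono a) (hb : StrictMono b)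
    (haW : ∀ j, a j < W) (hbW : ∀ j, b j < W) :
    HasPathMatching W (univ.image a) (univ.image b) ↔
      (∀ j, a j ≤ b j) ∧ ∀ i j, i < j → b i < a j := by
  constructor
  · rintro ⟨L, R, h⟩
    constructor
    · intro j
      have h1 := card_filter_eq_of_isPathMatching h (n := b j + 1) (hbW j) (by
        intro m hm hR
        obtain rfl : b j = m := by omega
        have := ((h.right_iff (b j)).2 (Or.inr hR)).2
        simp at this)
      have h2 := (lt_card_filter_iff hb (b j + 1) j).2 (by omega)
      rw [← h1, lt_card_filter_iff ha] at h2
      omega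
    · intro i j hij
      have h1 := card_filter_eq_of_isPathMatching h (n := a j) (haW j).le (by
        intro m hm hR
        have := ((h.succ_iff m).2 (Or.inr hR)).2
        rw [← hm] at this
        simp at this)
      have h2 := (lt_card_filter_iff ha (a j) i).2 (ha hij)
      rwa [h1, lt_card_filter_iff hb] at h2
  · rintro ⟨h1, h2⟩
    refine ⟨fun y => y < W ∧ (∀ j, b j ≠ y) ∧ ¬ ∃ j, a j ≤ y ∧ y < b j,
      fun y => ∃ j, a j ≤ y ∧ y < b j, ?_, ?_, ?_, ?_, ?_⟩
    · intro y
      simp only [Finset.mem_image, mem_univ, true_and, not_exists]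
      constructor
      · rintro ⟨hy, hb'⟩
        by_cases h : ∃ j, a j ≤ y ∧ y < b j
        · exact Or.inr h
        · exact Or.inl ⟨hy, hb', by simpa using h⟩
      · rintro (⟨hy, hb', _⟩ | ⟨j, hj1, hj2⟩)
        · exact ⟨hy, hb'⟩
        · refine ⟨hj2.trans (hbW j), fun i hi => ?_⟩
          have : i < j := hb.lt_iff_lt.1 (by omega)
          have := h2 i j this
          omega
    · rintro y ⟨⟨_, _, h⟩, h'⟩; exact h h'
    · simp only [Finset.mem_image, mem_univ, true_and, not_exists]
      constructor
      · rintro ⟨hW, h⟩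
        refine ⟨hW, fun j hj => ?_, fun j hj => ?_⟩
        · have := h1 j; exact h j (by omega)
        · exact h j (by omega)
      · rintro ⟨hW, h, h'⟩
        refine ⟨hW, fun j hj => ?_⟩
        have := h j; have := h' j
        omega
    · intro y
      simp only [Finset.mem_image, mem_univ, true_and, not_exists]
      constructor
      · rintro ⟨hW, h⟩
        by_cases hR : ∃ j, a j ≤ y ∧ y < b j
        · exact Or.inr hR
        · refine Or.inl ⟨hW, fun j hj => ?_, fun j hj => ?_⟩
          · refine hR ⟨j, ?_, by omega⟩
            have := h1 j; have := h j; omega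
          · refine hR ⟨j, ?_, by omega⟩
            have := h j; omega
      · rintro (⟨hW, h, h'⟩ | ⟨j, hj1, hj2⟩)
        · refine ⟨hW, fun j hj => ?_⟩
          have := h j; have := h' j; have := h1 j
          omega
        · refine ⟨by have := hbW j; omega, fun i hi => ?_⟩
          have : j < i := ha.lt_iff_lt.1 (by omega)
          have := h2 j i this
          omega
    · rintro y ⟨⟨hW, h, h'⟩, j, hj1, hj2⟩
      exact h' ⟨j, by omega, by have := h j; omega⟩

lemma exists_strictMono_image_eq {k : ℕ} {A : Finset ℕ} (h : #A = k) :
    ∃ a : Fin k → ℕ, StrictMono a ∧ A = univ.image a := by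
  refine ⟨A.orderEmbOfFin h, (A.orderEmbOfFin h).strictMono, ?_⟩
  rw [← Finset.coe_inj]
  simp

lemma strictMono_eq_of_image_eq {k : ℕ} {a b : Fin k → ℕ} (ha : StrictMono a) (hb : StrictMono b)
    (h : univ.image a = univ.image b) : a = b := by
  rw [← StrictMono.range_inj ha hb]
  simpa [← Finset.coe_inj] using h

lemma mem_piFinset_Ico_vecCons_iff {k : ℕ} {b : Fin (k + 1) → ℕ} (hb : StrictMono b)
    {c : Fin (k + 1) → ℕ} : c ∈ Fintype.piFinset (fun j : Fin (k + 1) =>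
        Ico ((Matrix.vecCons 0 fun i : Fin k => b i.castSucc + 1) j) (b j + 1)) ↔
        (∀ j, c j ≤ b j) ∧ ∀ i j, i < j → b i < c j := by
  simp only [Fintype.mem_piFinset, Finset.mem_Ico, Nat.lt_succ_iff]
  constructor
  · intro h
    refine ⟨fun j => (h j).2, fun i j hij => ?_⟩
    obtain ⟨j, rfl⟩ := Fin.exists_succ_eq.2 (Fin.ne_zero_of_lt hij)
    have h1 := (h j.succ).1
    simp only [Matrix.cons_val_succ] at h1
    have h2 : b i ≤ b j.castSucc := hb.monotone (Fin.le_castSucc_iff.2 hij)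
    omega
  · rintro ⟨h1, h2⟩ j
    refine ⟨?_, h1 j⟩
    refine Fin.cases (by simp) (fun j => ?_) j
    simpa using h2 j.castSucc j.succ Fin.castSucc_lt_succ

lemma strictMono_of_interlace {k : ℕ} {b c : Fin k → ℕ}
    (h : (∀ j, c j ≤ b j) ∧ ∀ i j, i < j → b i < c j) : StrictMono c :=
  fun i j hij => (h.1 i).trans_lt (h.2 i j hij)

lemma strictMono_of_mem_piFinset_Ico {k : ℕ} {a : Fin (k + 1) → ℕ} (ha : StrictMono a)
    {b : Fin k → ℕ}
    (hb : b ∈ Fintype.piFinset (fun j : Fin k => Ico (a j.castSucc) (a j.succ))) :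
    StrictMono b := by
  intro i j hij
  have h1 := Finset.mem_Ico.1 (Fintype.mem_piFinset.1 hb i)
  have h2 := Finset.mem_Ico.1 (Fintype.mem_piFinset.1 hb j)
  have : a i.succ ≤ a j.castSucc := ha.monotone (by simpa [Fin.le_def] using hij)
  omega

lemma lt_of_mem_piFinset_Ico {W k : ℕ} {a : Fin (k + 1) → ℕ} (haW : ∀ j, a j < W + 1)
    {b : Fin k → ℕ}
    (hb : b ∈ Fintype.piFinset (fun j : Fin k => Ico (a j.castSucc) (a j.succ))) (j : Fin k) :
    b j < W := by
  have h1 := Finset.mem_Ico.1 (Fintype.mem_piFinset.1 hb j)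
  have := haW j.succ
  omega

open Classical in
/-- Summation over the sets interlacing a given one from the odd side. -/
lemma sum_hasPathMatching_left {W k : ℕ} {b : Fin (k + 1) → ℕ} (hb : StrictMono b)
    (hbW : ∀ j, b j < W) (f : Finset ℕ → ℚ) :
    ∑ A ∈ (range W).powerset, (if HasPathMatching W A (univ.image b) then 1 else 0) * f A =
      ∑ c ∈ Fintype.piFinset (fun j : Fin (k + 1) =>
        Ico ((Matrix.vecCons 0 fun i : Fin k => b i.castSucc + 1) j) (b j + 1)),
        f (univ.image c) := by
  have h_interlace := fun c => mem_piFinset_Ico_vecCons_iff hb (c := c)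
  simp only [ite_mul, one_mul, zero_mul]
  rw [← Finset.sum_filter, ← Finset.sum_image (g := fun c : Fin (k + 1) → ℕ => univ.image c)]
  · apply Finset.sum_congr _ fun _ _ => rfl
    ext A
    simp only [Finset.mem_filter, Finset.mem_powerset, Finset.mem_image, h_interlace]
    constructor
    · rintro ⟨hA, h⟩
      have hc := h.card_eq hA (by
        intro i hi; obtain ⟨j, _, rfl⟩ := Finset.mem_image.1 hi; simpa using hbW j)
      rw [Finset.card_image_of_injective _ hb.injective, Finset.card_univ, Fintype.card_fin] at hc
      obtain ⟨a, ha, rfl⟩ := exists_strictMono_image_eq hc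
      rw [hasPathMatching_iff ha hb _ hbW] at h
      · exact ⟨a, h, rfl⟩
      · intro j; simpa using hA (Finset.mem_image_of_mem a (mem_univ j))
    · rintro ⟨c, hc, rfl⟩
      have hcW : ∀ j, c j < W := fun j => (hc.1 j).trans_lt (hbW j)
      refine ⟨?_, (hasPathMatching_iff (strictMono_of_interlace hc) hb hcW hbW).2 hc⟩
      intro i hi; obtain ⟨j, _, rfl⟩ := Finset.mem_image.1 hi; simpa using hcW j
  · intro c hc d hd h
    exact strictMono_eq_of_image_eq (strictMono_of_interlace ((h_interlace c).1 hc))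
      (strictMono_of_interlace ((h_interlace d).1 hd)) h

open Classical in
/-- Summation over the sets interlacing a given one from the even side. -/
lemma sum_hasPathMatching_right {W k : ℕ} {a : Fin (k + 1) → ℕ} (ha : StrictMono a)
    (haW : ∀ j, a j < W + 1) (f : Finset ℕ → ℚ) :
    ∑ B ∈ (range W).powerset,
        (if HasPathMatching (W + 1) (univ.image a) (insert W B) then 1 else 0) * f B =
      ∑ b ∈ Fintype.piFinset (fun j : Fin k => Ico (a j.castSucc) (a j.succ)),
        f (univ.image b) := by
  have hsm := fun b => strictMono_of_mem_piFinset_Ico ha (b := b)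
  have hsnoc : ∀ b : Fin k → ℕ, StrictMono b → (∀ j, b j < W) →
      StrictMono (Fin.snoc b W : Fin (k + 1) → ℕ) ∧
      (∀ j, (Fin.snoc b W : Fin (k + 1) → ℕ) j < W + 1) ∧
      univ.image (Fin.snoc b W : Fin (k + 1) → ℕ) = insert W (univ.image b) ∧
      (((∀ j, a j ≤ (Fin.snoc b W : Fin (k + 1) → ℕ) j) ∧
        ∀ i j, i < j → (Fin.snoc b W : Fin (k + 1) → ℕ) i < a j) ↔
      b ∈ Fintype.piFinset (fun j : Fin k => Ico (a j.castSucc) (a j.succ))) := by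
    intro b hb hbW
    refine ⟨?_, ?_, ?_, ?_⟩
    · intro i j
      refine Fin.lastCases ?_ (fun i => ?_) i
      · intro h; exact absurd h (Fin.le_last j).not_gt
      · refine Fin.lastCases ?_ (fun j => ?_) j
        · intro _; simpa using hbW i
        · intro h; simpa using hb (by simpa using h)
    · intro j
      refine Fin.lastCases ?_ (fun i => ?_) j
      · simp
      · simpa using (hbW i).trans (Nat.lt_succ_self W)
    · ext i
      simp [Fin.exists_fin_succ', eq_comm, or_comm]
    · simp only [Fintype.mem_piFinset, Finset.mem_Ico]
      constructor
      · rintro ⟨h1, h2⟩ j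
        have := h1 j.castSucc; have := h2 j.castSucc j.succ Fin.castSucc_lt_succ
        simp only [Fin.snoc_castSucc] at *
        omega
      · intro h
        constructor
        · intro j
          refine Fin.lastCases ?_ (fun i => ?_) j
          · simpa [Nat.lt_succ_iff] using haW (Fin.last k)
          · simpa using (h i).1
        · intro i j
          refine Fin.lastCases ?_ (fun i => ?_) i
          · intro h; exact absurd h (Fin.le_last j).not_gt
          · intro hij
            have : a i.succ ≤ a j := ha.monotone (by
              simpa [Fin.le_def, Fin.lt_def, Nat.succ_le_iff] using hij)
            simpa using (h i).2.trans_le this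
  have hlt := fun b => lt_of_mem_piFinset_Ico haW (b := b)
  simp only [ite_mul, one_mul, zero_mul]
  rw [← Finset.sum_filter, ← Finset.sum_image (g := fun c : Fin k → ℕ => univ.image c)]
  · apply Finset.sum_congr _ fun _ _ => rfl
    ext B
    simp only [Finset.mem_filter, Finset.mem_powerset, Finset.mem_image]
    constructor
    · rintro ⟨hB, h⟩
      have hWB : W ∉ B := fun hc => by simpa using hB hc
      have hc := h.card_eq (by
        intro i hi; obtain ⟨j, _, rfl⟩ := Finset.mem_image.1 hi; simpa using haW j)
        (by
          intro i hi
          rcases Finset.mem_insert.1 hi with rfl | hi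
          · simp
          · have := Finset.mem_range.1 (hB hi); simp; omega)
      rw [Finset.card_image_of_injective _ ha.injective, Finset.card_univ, Fintype.card_fin,
        Finset.card_insert_of_notMem hWB] at hc
      obtain ⟨b, hb, rfl⟩ := exists_strictMono_image_eq (k := k) (A := B) (by omega)
      have hbW : ∀ j, b j < W := fun j => by
        simpa using hB (Finset.mem_image_of_mem b (mem_univ j))
      obtain ⟨s1, s2, s3, s4⟩ := hsnoc b hb hbW
      rw [← s3, hasPathMatching_iff ha s1 haW s2, s4] at h
      exact ⟨b, h, rfl⟩
    · rintro ⟨b, hb, rfl⟩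
      obtain ⟨s1, s2, s3, s4⟩ := hsnoc b (hsm b hb) (hlt b hb)
      refine ⟨?_, ?_⟩
      · intro i hi; obtain ⟨j, _, rfl⟩ := Finset.mem_image.1 hi; simpa using hlt b hb j
      · rw [← s3, hasPathMatching_iff ha s1 haW s2, s4]; exact hb
  · intro c hc d hd h
    exact strictMono_eq_of_image_eq (hsm c hc) (hsm d hd) h

end PathMatching

section Tilings

/-- The up-pointing half of a lozenge. -/
def upHalf (l : Loz) : Tri := upT l.1.1 l.1.2

/-- The down-pointing half of a lozenge. -/
def dnHalf (l : Loz) : Tri := dnT l.2.1 l.2.2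

lemma upHalf_ne_dnHalf (l l' : Loz) : upHalf l ≠ dnHalf l' := by
  simp [upHalf, dnHalf, upT, dnT]

lemma isTiling_iff {R : Finset Tri} {T : Finset Loz} : IsTiling R T ↔
    (∀ l ∈ T, lozAdj l ∧ upHalf l ∈ R ∧ dnHalf l ∈ R) ∧
    (∀ t ∈ R, ∃ l ∈ T, t = upHalf l ∨ t = dnHalf l) ∧
    (∀ l ∈ T, ∀ l' ∈ T, upHalf l = upHalf l' ∨ dnHalf l = dnHalf l' → l = l') := by
  constructor
  · rintro ⟨h1, h2⟩
    refine ⟨h1, fun t ht => ?_, fun l hl l' hl' h => ?_⟩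
    · obtain ⟨l, ⟨hl, h⟩, _⟩ := h2 t ht
      exact ⟨l, hl, h⟩
    · rcases h with h | h
      · exact (h2 _ (h1 l hl).2.1).unique ⟨hl, Or.inl rfl⟩ ⟨hl', Or.inl h⟩
      · exact (h2 _ (h1 l hl).2.2).unique ⟨hl, Or.inr rfl⟩ ⟨hl', Or.inr h⟩
  · rintro ⟨h1, h2, h3⟩
    refine ⟨h1, fun t ht => ?_⟩
    obtain ⟨l, hl, h⟩ := h2 t ht
    refine ⟨l, ⟨hl, h⟩, ?_⟩
    rintro l' ⟨hl', h'⟩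
    refine h3 l' hl' l hl ?_
    change t = upHalf l' ∨ t = dnHalf l' at h'
    rcases h with rfl | rfl <;> rcases h' with h' | h'
    · exact Or.inl h'.symm
    · exact absurd h' (upHalf_ne_dnHalf _ _)
    · exact absurd h'.symm (upHalf_ne_dnHalf _ _)
    · exact Or.inr h'.symm

lemma mem_tilings {R : Finset Tri} {F T : Finset Loz} :
    T ∈ tilings R F ↔ IsTiling R T ∧ ∀ l ∈ T, l ∉ F := by
  simp only [tilings, Finset.mem_filter, Finset.mem_powerset, and_iff_right_iff_imp]
  rintro ⟨h, -⟩ l hl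
  obtain ⟨_, h1, h2⟩ := h.1 l hl
  exact Finset.mem_product.2 ⟨Finset.mem_image.2 ⟨_, h1, rfl⟩, Finset.mem_image.2 ⟨_, h2, rfl⟩⟩

lemma Mtil_eq_of_disjoint {R : Finset Tri} {F : Finset Loz}
    (h : ∀ l ∈ F, upHalf l ∈ R → dnHalf l ∉ R) : Mtil R F = Mtil R ∅ := by
  unfold Mtil
  congr 1
  ext T
  simp only [mem_tilings, Finset.notMem_empty, not_false_eq_true, implies_true, and_true,
    and_iff_left_iff_imp]
  intro hT l hl hF
  exact h l hF (hT.1 l hl).2.1 (hT.1 l hl).2.2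

lemma isTiling_empty_iff {T : Finset Loz} : IsTiling ∅ T ↔ T = ∅ := by
  rw [isTiling_iff]
  constructor
  · rintro ⟨h, -⟩
    exact Finset.eq_empty_of_forall_notMem fun l hl => by simpa using (h l hl).2.1
  · rintro rfl; simp

lemma Mtil_empty (F : Finset Loz) : Mtil ∅ F = 1 := by
  unfold Mtil
  rw [Finset.card_eq_one]
  refine ⟨∅, ?_⟩
  ext T
  simp only [mem_tilings, isTiling_empty_iff, Finset.mem_singleton, and_iff_left_iff_imp]
  rintro rfl; simp

lemma isTiling_union {R₁ R₂ : Finset Tri} {T₁ T₂ : Finset Loz} (hR : Disjoint R₁ R₂)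
    (h₁ : IsTiling R₁ T₁) (h₂ : IsTiling R₂ T₂) : IsTiling (R₁ ∪ R₂) (T₁ ∪ T₂) := by
  rw [isTiling_iff] at *
  rw [Finset.disjoint_left] at hR
  obtain ⟨a1, a2, a3⟩ := h₁
  obtain ⟨b1, b2, b3⟩ := h₂
  simp only [Finset.mem_union]
  refine ⟨?_, ?_, ?_⟩
  · grind
  · grind
  · grind

lemma isTiling_of_subset {R R' : Finset Tri} {T T' : Finset Loz} (h : IsTiling R T)
    (hR : R' ⊆ R) (hT : T' ⊆ T)
    (h' : ∀ l ∈ T, upHalf l ∈ R' ∨ dnHalf l ∈ R' → l ∈ T')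
    (hT' : ∀ l ∈ T', upHalf l ∈ R' ∧ dnHalf l ∈ R') : IsTiling R' T' := by
  rw [isTiling_iff] at *
  obtain ⟨a1, a2, a3⟩ := h
  refine ⟨fun l hl => ⟨(a1 l (hT hl)).1, hT' l hl⟩, fun t ht => ?_,
    fun l hl l' hl' => a3 l (hT hl) l' (hT hl')⟩
  obtain ⟨l, hl, h⟩ := a2 t (hR ht)
  refine ⟨l, h' l hl ?_, h⟩
  rcases h with rfl | rfl
  · exact Or.inl ht
  · exact Or.inr ht

/-- Cutting a region into two parts: every tiling is determined by the set of lozenges crossing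
the cut and by its restrictions to the two parts. -/
lemma Mtil_union_eq_sum {R₁ R₂ : Finset Tri} (F K : Finset Loz) (hR : Disjoint R₁ R₂)
    (hK : ∀ l, l ∈ K ↔ lozAdj l ∧ l ∉ F ∧ upHalf l ∈ R₁ ∧ dnHalf l ∈ R₂)
    (hno : ∀ l, lozAdj l → upHalf l ∈ R₂ → dnHalf l ∉ R₁)
    (hinj : ∀ l ∈ K, ∀ l' ∈ K, upHalf l = upHalf l' ∨ dnHalf l = dnHalf l' → l = l') :
    Mtil (R₁ ∪ R₂) F = ∑ S ∈ K.powerset,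
      Mtil (R₁ \ S.image upHalf) F * Mtil (R₂ \ S.image dnHalf) F := by
  classical
  have hmap : ∀ T ∈ tilings (R₁ ∪ R₂) F, T ∩ K ∈ K.powerset := fun T _ =>
    Finset.mem_powerset.2 Finset.inter_subset_right
  rw [Mtil, Finset.card_eq_sum_card_fiberwise hmap]
  refine Finset.sum_congr rfl fun S hS => ?_
  rw [Finset.mem_powerset] at hS
  rw [Mtil, Mtil, ← Finset.card_product]
  have hR' := Finset.disjoint_left.1 hR
  refine Finset.card_nbij'
    (fun T => (T.filter fun l => upHalf l ∈ R₁ ∧ dnHalf l ∈ R₁,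
      T.filter fun l => upHalf l ∈ R₂ ∧ dnHalf l ∈ R₂))
    (fun P => P.1 ∪ P.2 ∪ S) ?_ ?_ ?_ ?_
  · intro T hT
    simp only [Finset.coe_filter, Set.mem_ofPred_eq, mem_tilings] at hT
    obtain ⟨⟨h, hF⟩, hTK⟩ := hT
    have h' := isTiling_iff.1 h
    have hST : S ⊆ T := hTK ▸ Finset.inter_subset_left
    simp only [Finset.coe_product, Set.mem_prod, Finset.mem_coe, mem_tilings]
    refine ⟨⟨?_, fun l hl => hF l (Finset.mem_filter.1 hl).1⟩,
      ⟨?_, fun l hl => hF l (Finset.mem_filter.1 hl).1⟩⟩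
    · refine isTiling_of_subset h ?_ (Finset.filter_subset _ _) ?_ ?_
      · exact Finset.sdiff_subset.trans Finset.subset_union_left
      · intro l hl hh
        have := h'.1 l hl
        have := hF l hl
        have := hno l
        have := hK l
        have : l ∈ K → l ∈ S := fun h => hTK ▸ Finset.mem_inter.2 ⟨hl, h⟩
        grind
      · intro l hl
        obtain ⟨hl, h1, h2⟩ := Finset.mem_filter.1 hl
        have : ∀ l' ∈ S, upHalf l' = upHalf l → l ∈ K := fun l' hl' e =>
          hS (h'.2.2 l' (hST hl') l hl (Or.inl e) ▸ hl')
        have h3 := hK l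
        have h4 : ∀ l' ∈ S, upHalf l' ≠ dnHalf l := fun l' _ => upHalf_ne_dnHalf _ _
        simp only [Finset.mem_sdiff, Finset.mem_image, not_exists, not_and]
        grind
    · refine isTiling_of_subset h ?_ (Finset.filter_subset _ _) ?_ ?_
      · exact Finset.sdiff_subset.trans Finset.subset_union_right
      · intro l hl hh
        have := h'.1 l hl
        have := hF l hl
        have := hno l
        have := hK l
        have : l ∈ K → l ∈ S := fun h => hTK ▸ Finset.mem_inter.2 ⟨hl, h⟩
        grind
      · intro l hl
        obtain ⟨hl, h1, h2⟩ := Finset.mem_filter.1 hl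
        have : ∀ l' ∈ S, dnHalf l' = dnHalf l → l ∈ K := fun l' hl' e =>
          hS (h'.2.2 l' (hST hl') l hl (Or.inr e) ▸ hl')
        have h3 := hK l
        have h4 : ∀ l' ∈ S, dnHalf l' ≠ upHalf l := fun l' _ => (upHalf_ne_dnHalf _ _).symm
        simp only [Finset.mem_sdiff, Finset.mem_image, not_exists, not_and]
        grind
  · rintro ⟨T₁, T₂⟩ hP
    simp only [Finset.coe_product, Set.mem_prod, Finset.mem_coe, mem_tilings] at hP
    obtain ⟨⟨h1, f1⟩, ⟨h2, f2⟩⟩ := hP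
    have hSt : IsTiling (S.image upHalf ∪ S.image dnHalf) S := by
      rw [isTiling_iff]
      refine ⟨fun l hl => ⟨((hK l).1 (hS hl)).1, ?_, ?_⟩, ?_, fun l hl l' hl' =>
        hinj l (hS hl) l' (hS hl')⟩
      · exact Finset.mem_union_left _ (Finset.mem_image_of_mem _ hl)
      · exact Finset.mem_union_right _ (Finset.mem_image_of_mem _ hl)
      · intro t ht
        simp only [Finset.mem_union, Finset.mem_image] at ht
        grind
    have hu : ∀ l ∈ S, upHalf l ∈ R₁ := fun l hl => ((hK l).1 (hS hl)).2.2.1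
    have hv : ∀ l ∈ S, dnHalf l ∈ R₂ := fun l hl => ((hK l).1 (hS hl)).2.2.2
    have e : R₁ ∪ R₂ = (R₁ \ S.image upHalf ∪ R₂ \ S.image dnHalf) ∪
        (S.image upHalf ∪ S.image dnHalf) := by
      ext t
      simp only [Finset.mem_union, Finset.mem_sdiff, Finset.mem_image]
      grind
    simp only [Finset.coe_filter, Set.mem_ofPred_eq, mem_tilings]
    refine ⟨⟨?_, ?_⟩, ?_⟩
    · rw [e]
      refine isTiling_union ?_ (isTiling_union ?_ h1 h2) hSt
      · rw [Finset.disjoint_left]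
        simp only [Finset.mem_union, Finset.mem_sdiff, Finset.mem_image]
        grind
      · rw [Finset.disjoint_left]
        simp only [Finset.mem_sdiff]
        grind
    · intro l hl
      simp only [Finset.mem_union] at hl
      have := hK l
      grind
    · ext l
      simp only [Finset.mem_inter, Finset.mem_union]
      constructor
      · rintro ⟨(h | h) | h, hl⟩
        · have a := (h1.1 l h).2.2
          have b := ((hK l).1 hl).2.2.2
          exact absurd b (hR' (Finset.mem_sdiff.1 a).1)
        · have a := (h2.1 l h).2.1
          have b := ((hK l).1 hl).2.2.1
          exact absurd (Finset.mem_sdiff.1 a).1 (hR' b)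
        · exact h
      · intro h; exact ⟨Or.inr h, hS h⟩
  · intro T hT
    simp only [Finset.coe_filter, Set.mem_ofPred_eq, mem_tilings] at hT
    obtain ⟨⟨h, hF⟩, hTK⟩ := hT
    ext l
    have h1 : l ∈ S ↔ l ∈ T ∧ l ∈ K := by rw [← hTK, Finset.mem_inter]
    have h2 := h.1 l
    change l ∈ T → lozAdj l ∧ upHalf l ∈ _ ∧ dnHalf l ∈ _ at h2
    have := hF l; have := hno l; have := hK l
    simp only [Finset.mem_union, Finset.mem_filter] at *
    grind
  · rintro ⟨T₁, T₂⟩ hP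
    simp only [Finset.coe_product, Set.mem_prod, Finset.mem_coe, mem_tilings] at hP
    obtain ⟨⟨h1, f1⟩, ⟨h2, f2⟩⟩ := hP
    ext l
    all_goals
      have h1' := h1.1 l
      have h2' := h2.1 l
      change l ∈ T₁ → lozAdj l ∧ upHalf l ∈ _ ∧ dnHalf l ∈ _ at h1'
      change l ∈ T₂ → lozAdj l ∧ upHalf l ∈ _ ∧ dnHalf l ∈ _ at h2'
      have := hK l
      have := @hS l
      have := @hR' (upHalf l)
      have := @hR' (dnHalf l)
      simp only [Finset.mem_union, Finset.mem_filter, Finset.mem_sdiff] at *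
      grind


lemma reflTri_reflTri (t : Tri) : reflTri (reflTri t) = t := by
  obtain ⟨b, p, q⟩ := t
  cases b <;> simp only [reflTri] <;> ext <;> (simp; try ring)

lemma reflLoz_reflLoz (l : Loz) : reflLoz (reflLoz l) = l := by
  obtain ⟨⟨a, b⟩, c, d⟩ := l
  ext <;> (simp [reflLoz]; try ring)

lemma upHalf_reflLoz (l : Loz) : upHalf (reflLoz l) = reflTri (dnHalf l) := by
  simp [upHalf, dnHalf, reflLoz, reflTri, upT, dnT]

lemma dnHalf_reflLoz (l : Loz) : dnHalf (reflLoz l) = reflTri (upHalf l) := by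
  simp [upHalf, dnHalf, reflLoz, reflTri, upT, dnT]

lemma lozAdj_reflLoz {l : Loz} (h : lozAdj l) : lozAdj (reflLoz l) := by
  obtain ⟨⟨a, b⟩, c, d⟩ := l
  simp only [lozAdj, reflLoz, Prod.mk.injEq] at *
  omega

lemma isTiling_image_refl {R : Finset Tri} {T : Finset Loz} (h : IsTiling R T) :
    IsTiling (R.image reflTri) (T.image reflLoz) := by
  rw [isTiling_iff] at *
  obtain ⟨h1, h2, h3⟩ := h
  have hinj : Function.Injective reflTri := Function.LeftInverse.injective reflTri_reflTri
  simp only [Finset.forall_mem_image, upHalf_reflLoz, dnHalf_reflLoz, hinj.mem_finset_image,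
    hinj.eq_iff, Finset.exists_mem_image]
  refine ⟨fun l hl => ⟨lozAdj_reflLoz (h1 l hl).1, (h1 l hl).2.2, (h1 l hl).2.1⟩,
    fun t ht => ?_, fun l hl l' hl' h => ?_⟩
  · obtain ⟨l, hl, h⟩ := h2 t ht
    exact ⟨l, hl, h.symm⟩
  · rw [h3 l hl l' hl' h.symm]

lemma Mtil_image_refl (R : Finset Tri) : Mtil (R.image reflTri) ∅ = Mtil R ∅ := by
  have hR : ∀ R : Finset Tri, (R.image reflTri).image reflTri = R := fun R => by
    simp [Finset.image_image, Function.comp_def, reflTri_reflTri]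
  have hT : ∀ T : Finset Loz, (T.image reflLoz).image reflLoz = T := fun T => by
    simp [Finset.image_image, Function.comp_def, reflLoz_reflLoz]
  refine Finset.card_nbij' (fun T => T.image reflLoz) (fun T => T.image reflLoz) ?_ ?_
    (fun T _ => hT T) (fun T _ => hT T)
  · intro T hT
    simp only [Finset.mem_coe, mem_tilings, Finset.notMem_empty, not_false_eq_true, implies_true,
      and_true] at *
    simpa [hR] using isTiling_image_refl hT
  · intro T hT
    simp only [Finset.mem_coe, mem_tilings, Finset.notMem_empty, not_false_eq_true, implies_true,
      and_true] at *
    exact isTiling_image_refl hT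

open Classical in
/-- A region whose dual graph is an induced subgraph of the path `x 0, y 0, x 1, y 1, …` has at
most one tiling. -/
lemma Mtil_eq_ite_isPathMatching {R : Finset Tri} {x y : ℕ → Tri} {lL lR : ℕ → Loz}
    (hx : Function.Injective x) (hy : Function.Injective y) (hxy : ∀ i j, x i ≠ y j)
    (hL : ∀ i t, t = upHalf (lL i) ∨ t = dnHalf (lL i) ↔ t = x i ∨ t = y i)
    (hLR : ∀ i t, t = upHalf (lR i) ∨ t = dnHalf (lR i) ↔ t = y i ∨ t = x (i + 1))
    (hLa : ∀ i, lozAdj (lL i)) (hRa : ∀ i, lozAdj (lR i))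
    (hR : ∀ t ∈ R, ∃ i, t = x i ∨ t = y i)
    (hc : ∀ l, lozAdj l → upHalf l ∈ R → dnHalf l ∈ R → ∃ i, l = lL i ∨ l = lR i) :
    Mtil R ∅ = if ∃ P Q, IsPathMatching (fun i => x i ∈ R) (fun i => y i ∈ R) P Q
      then 1 else 0 := by
  have cov : ∀ {T t}, IsTiling R T → t ∈ R → ∃ l ∈ T, t = upHalf l ∨ t = dnHalf l :=
    fun h ht => (isTiling_iff.1 h).2.1 _ ht
  have uniq : ∀ {T l l' t}, IsTiling R T → l ∈ T → l' ∈ T → (t = upHalf l ∨ t = dnHalf l) →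
      (t = upHalf l' ∨ t = dnHalf l') → l = l' := by
    intro T l l' t h hl hl' h1 h2
    refine (isTiling_iff.1 h).2.2 l hl l' hl' ?_
    have := upHalf_ne_dnHalf l l'
    have := upHalf_ne_dnHalf l' l
    grind
  have mem : ∀ {T l t}, IsTiling R T → l ∈ T → (t = upHalf l ∨ t = dnHalf l) → t ∈ R := by
    intro T l t h hl h1
    have := ((isTiling_iff.1 h).1 l hl).2
    grind
  have hLRne : ∀ i j, lL i ≠ lR j := by
    intro i j h
    have h1 := hL i; have h2 := hLR j
    rw [h] at h1
    have h3 : ∀ t, t = x i ∨ t = y i ↔ t = y j ∨ t = x (j + 1) := fun t =>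
      (h1 t).symm.trans (h2 t)
    have a := (h3 (x i)).1 (Or.inl rfl)
    have b := (h3 (y i)).1 (Or.inr rfl)
    have := hxy i j; have := hxy (j + 1) i
    have := @hx i (j + 1); have := @hy i j
    grind
  have key : ∀ {T}, IsTiling R T → IsPathMatching (fun i => x i ∈ R) (fun i => y i ∈ R)
      (fun i => lL i ∈ T) (fun i => lR i ∈ T) := by
    intro T h
    have hcT : ∀ l ∈ T, ∃ i, l = lL i ∨ l = lR i := fun l hl =>
      hc l (h.1 l hl).1 (h.1 l hl).2.1 (h.1 l hl).2.2
    refine ⟨fun i => ⟨fun hi => ?_, ?_⟩, ?_, ⟨fun hi => ?_, ?_⟩, fun i => ⟨fun hi => ?_, ?_⟩, ?_⟩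
    · obtain ⟨l, hl, hi'⟩ := cov h hi
      obtain ⟨j, rfl | rfl⟩ := hcT l hl
      · rw [hL] at hi'
        have := hxy j i; have := @hy i j
        grind
      · rw [hLR] at hi'
        have := hxy (j + 1) i; have := @hy i j
        grind
    · rintro (hi | hi)
      · exact mem h hi ((hL _ _).2 (Or.inr rfl))
      · exact mem h hi ((hLR _ _).2 (Or.inl rfl))
    · rintro i ⟨h1, h2⟩
      exact hLRne _ _ (uniq h h1 h2 ((hL _ _).2 (Or.inr rfl)) ((hLR _ _).2 (Or.inl rfl)))
    · obtain ⟨l, hl, hi'⟩ := cov h hi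
      obtain ⟨j, rfl | rfl⟩ := hcT l hl
      · rw [hL] at hi'
        have := hxy 0 j; have := @hx 0 j
        grind
      · rw [hLR] at hi'
        have := hxy 0 j; have := @hx 0 (j + 1)
        grind
    · intro hi
      exact mem h hi ((hL _ _).2 (Or.inl rfl))
    · obtain ⟨l, hl, hi'⟩ := cov h hi
      obtain ⟨j, rfl | rfl⟩ := hcT l hl
      · rw [hL] at hi'
        have := hxy (i + 1) j; have := @hx (i + 1) j
        grind
      · rw [hLR] at hi'
        have := hxy (i + 1) j; have := @hx (i + 1) (j + 1)
        grind
    · rintro (hi | hi)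
      · exact mem h hi ((hL _ _).2 (Or.inl rfl))
      · exact mem h hi ((hLR _ _).2 (Or.inr rfl))
    · rintro i ⟨h1, h2⟩
      exact hLRne _ _ (uniq h h1 h2 ((hL _ _).2 (Or.inl rfl)) ((hLR _ _).2 (Or.inr rfl)))
  split_ifs with hP
  · obtain ⟨P, Q, hP⟩ := hP
    rw [Mtil, Finset.card_eq_one]
    have hPR : ∀ i, P i → x i ∈ R ∧ y i ∈ R := by
      intro i hi
      refine ⟨?_, (hP.right_iff i).2 (Or.inl hi)⟩
      cases i with
      | zero => exact hP.zero_iff.2 hi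
      | succ i => exact (hP.succ_iff i).2 (Or.inl hi)
    have hQR : ∀ i, Q i → y i ∈ R ∧ x (i + 1) ∈ R := fun i hi =>
      ⟨(hP.right_iff i).2 (Or.inr hi), (hP.succ_iff i).2 (Or.inr hi)⟩
    have hmR : ∀ l, (∃ i, P i ∧ l = lL i ∨ Q i ∧ l = lR i) →
        lozAdj l ∧ upHalf l ∈ R ∧ dnHalf l ∈ R := by
      rintro l ⟨i, ⟨hi, rfl⟩ | ⟨hi, rfl⟩⟩
      · refine ⟨hLa i, ?_, ?_⟩
        · rcases (hL i _).1 (Or.inl rfl) with e | e <;> rw [e]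
          exacts [(hPR i hi).1, (hPR i hi).2]
        · rcases (hL i _).1 (Or.inr rfl) with e | e <;> rw [e]
          exacts [(hPR i hi).1, (hPR i hi).2]
      · refine ⟨hRa i, ?_, ?_⟩
        · rcases (hLR i _).1 (Or.inl rfl) with e | e <;> rw [e]
          exacts [(hQR i hi).1, (hQR i hi).2]
        · rcases (hLR i _).1 (Or.inr rfl) with e | e <;> rw [e]
          exacts [(hQR i hi).1, (hQR i hi).2]
    set T := (R.image Prod.snd ×ˢ R.image Prod.snd).filter
      (fun l : Loz => ∃ i, P i ∧ l = lL i ∨ Q i ∧ l = lR i) with hTdef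
    have hT : ∀ l, l ∈ T ↔ ∃ i, P i ∧ l = lL i ∨ Q i ∧ l = lR i := by
      intro l
      rw [hTdef, Finset.mem_filter, and_iff_right_iff_imp]
      intro hl
      obtain ⟨_, h1, h2⟩ := hmR l hl
      exact Finset.mem_product.2
        ⟨Finset.mem_image.2 ⟨_, h1, rfl⟩, Finset.mem_image.2 ⟨_, h2, rfl⟩⟩
    have hTt : IsTiling R T := by
      rw [isTiling_iff]
      refine ⟨fun l hl => hmR l ((hT l).1 hl), fun t ht => ?_, fun l hl l' hl' h => ?_⟩
      · obtain ⟨i, rfl | rfl⟩ := hR t ht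
        · cases i with
          | zero => exact ⟨lL 0, (hT _).2 ⟨0, Or.inl ⟨hP.zero_iff.1 ht, rfl⟩⟩,
              (hL _ _).2 (Or.inl rfl)⟩
          | succ i =>
            rcases (hP.succ_iff i).1 ht with h | h
            · exact ⟨lL (i + 1), (hT _).2 ⟨i + 1, Or.inl ⟨h, rfl⟩⟩, (hL _ _).2 (Or.inl rfl)⟩
            · exact ⟨lR i, (hT _).2 ⟨i, Or.inr ⟨h, rfl⟩⟩, (hLR _ _).2 (Or.inr rfl)⟩
        · rcases (hP.right_iff i).1 ht with h | h
          · exact ⟨lL i, (hT _).2 ⟨i, Or.inl ⟨h, rfl⟩⟩, (hL _ _).2 (Or.inr rfl)⟩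
          · exact ⟨lR i, (hT _).2 ⟨i, Or.inr ⟨h, rfl⟩⟩, (hLR _ _).2 (Or.inl rfl)⟩
      · obtain ⟨t, h1, h2⟩ : ∃ t, (t = upHalf l ∨ t = dnHalf l) ∧
            (t = upHalf l' ∨ t = dnHalf l') := by
          rcases h with h | h
          · exact ⟨_, Or.inl rfl, Or.inl h⟩
          · exact ⟨_, Or.inr rfl, Or.inr h⟩
        obtain ⟨i, ⟨hi, rfl⟩ | ⟨hi, rfl⟩⟩ := (hT l).1 hl <;>
          obtain ⟨j, ⟨hj, rfl⟩ | ⟨hj, rfl⟩⟩ := (hT l').1 hl' <;>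
          simp only [hL, hLR] at h1 h2
        · have := @hx i j; have := @hy i j; have := hxy i j; have := hxy j i
          grind
        · have := @hx i (j + 1); have := @hy i j; have := hxy i j; have := hxy (j + 1) i
          have := hP.right_excl j; have := hP.succ_excl j
          grind
        · have := @hx j (i + 1); have := @hy i j; have := hxy j i; have := hxy (i + 1) j
          have := hP.right_excl i; have := hP.succ_excl i
          grind
        · have := @hx (i + 1) (j + 1); have := @hy i j
          have := hxy (i + 1) j; have := hxy (j + 1) i
          grind
    refine ⟨T, ?_⟩
    ext T'
    simp only [mem_tilings, Finset.notMem_empty, not_false_eq_true, implies_true, and_true,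
      Finset.mem_singleton]
    constructor
    · intro h
      have hu := (key h).unique hP
      ext l
      rw [hT]
      constructor
      · intro hl
        obtain ⟨i, rfl | rfl⟩ := hc l (h.1 l hl).1 (h.1 l hl).2.1 (h.1 l hl).2.2
        · exact ⟨i, Or.inl ⟨(hu i).1.1 hl, rfl⟩⟩
        · exact ⟨i, Or.inr ⟨(hu i).2.1 hl, rfl⟩⟩
      · rintro ⟨i, ⟨hi, rfl⟩ | ⟨hi, rfl⟩⟩
        · exact (hu i).1.2 hi
        · exact (hu i).2.2 hi
    · rintro rfl; exact hTt
  · rw [Mtil, Finset.card_eq_zero]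
    refine Finset.eq_empty_of_forall_notMem fun T hT => hP ?_
    exact ⟨_, _, key (mem_tilings.1 hT).1⟩

end Tilings

section HexagonRows

/-- The `a`-th up-pointing triangle, from the west, of row `j` of a quartered hexagon. -/
def posUp (j a : ℕ) : Tri := upT ((a : ℤ) - ((j / 2 : ℕ) : ℤ)) (j : ℤ)

/-- The `a`-th down-pointing triangle, from the west, of row `j` of a quartered hexagon. -/
def posDn (j a : ℕ) : Tri := dnT ((a : ℤ) - (((j + 1) / 2 : ℕ) : ℤ)) (j : ℤ)

/-- Row `j` of a quartered hexagon with base of width `N`, with the up-pointing triangles `A` and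
the down-pointing triangles `B` removed. -/
def rowStrip (N j : ℕ) (A B : Finset ℕ) : Finset Tri :=
  (range (N - (j + 1) / 2) \ A).image (posUp j) ∪ (range (N - (j + 2) / 2) \ B).image (posDn j)

/-- The rows `j, …, m - 1` of a quartered hexagon with base of width `N`. -/
def rowsFrom (N m j : ℕ) : Finset Tri := (Ico j m).biUnion fun i => rowStrip N i ∅ ∅

lemma posUp_injective (j : ℕ) : Function.Injective (posUp j) := by
  intro a b h
  simp only [posUp, upT, Prod.mk.injEq] at h
  omega

lemma posDn_injective (j : ℕ) : Function.Injective (posDn j) := by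
  intro a b h
  simp only [posDn, dnT, Prod.mk.injEq] at h
  omega

lemma posUp_ne_posDn (i j a b : ℕ) : posUp i a ≠ posDn j b := by
  simp [posUp, posDn, upT, dnT]

lemma posUp_mem_rowStrip {N j : ℕ} {A B : Finset ℕ} {a : ℕ} :
    posUp j a ∈ rowStrip N j A B ↔ a < N - (j + 1) / 2 ∧ a ∉ A := by
  simp only [rowStrip, Finset.mem_union, (posUp_injective j).mem_finset_image, Finset.mem_sdiff,
    Finset.mem_range, Finset.mem_image, or_iff_left_iff_imp]
  rintro ⟨b, -, h⟩
  exact absurd h.symm (posUp_ne_posDn _ _ _ _)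

lemma posDn_mem_rowStrip {N j : ℕ} {A B : Finset ℕ} {a : ℕ} :
    posDn j a ∈ rowStrip N j A B ↔ a < N - (j + 2) / 2 ∧ a ∉ B := by
  simp only [rowStrip, Finset.mem_union, (posDn_injective j).mem_finset_image, Finset.mem_sdiff,
    Finset.mem_range, Finset.mem_image, or_iff_right_iff_imp]
  rintro ⟨b, -, h⟩
  exact absurd h (posUp_ne_posDn _ _ _ _)

lemma exists_of_mem_rowStrip {N j : ℕ} {A B : Finset ℕ} {t : Tri} (h : t ∈ rowStrip N j A B) :
    ∃ a, t = posUp j a ∨ t = posDn j a := by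
  simp only [rowStrip, Finset.mem_union, Finset.mem_image] at h
  rcases h with ⟨a, -, rfl⟩ | ⟨a, -, rfl⟩
  exacts [⟨a, Or.inl rfl⟩, ⟨a, Or.inr rfl⟩]

lemma upHalf_mem_rowStrip {N j : ℕ} {A B : Finset ℕ} {l : Loz} (h : upHalf l ∈ rowStrip N j A B) :
    ∃ a : ℕ, l.1 = ((a : ℤ) - ((j / 2 : ℕ) : ℤ), (j : ℤ)) := by
  obtain ⟨a, h | h⟩ := exists_of_mem_rowStrip h
  · simp only [upHalf, posUp, upT, Prod.mk.injEq, true_and] at h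
    exact ⟨a, Prod.ext h.1 h.2⟩
  · simp [upHalf, posDn, upT, dnT] at h

lemma dnHalf_mem_rowStrip {N j : ℕ} {A B : Finset ℕ} {l : Loz} (h : dnHalf l ∈ rowStrip N j A B) :
    ∃ a : ℕ, l.2 = ((a : ℤ) - (((j + 1) / 2 : ℕ) : ℤ), (j : ℤ)) := by
  obtain ⟨a, h | h⟩ := exists_of_mem_rowStrip h
  · simp [dnHalf, posUp, upT, dnT] at h
  · simp only [dnHalf, posDn, dnT, Prod.mk.injEq, true_and] at h
    exact ⟨a, Prod.ext h.1 h.2⟩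

open Classical in
lemma Mtil_rowStrip_even {N e : ℕ} (he : e < N) (A B : Finset ℕ) :
    Mtil (rowStrip N (2 * e) A B) ∅ =
      if HasPathMatching (N - e) A (insert (N - e - 1) B) then 1 else 0 := by
  rw [Mtil_eq_ite_isPathMatching (x := posUp (2 * e)) (y := posDn (2 * e))
    (lL := fun i => (((i : ℤ) - e, 2 * (e : ℤ)), ((i : ℤ) - e, 2 * (e : ℤ))))
    (lR := fun i => (((i : ℤ) + 1 - e, 2 * (e : ℤ)), ((i : ℤ) - e, 2 * (e : ℤ))))]
  · have h1 : (fun i => posUp (2 * e) i ∈ rowStrip N (2 * e) A B) =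
        fun i => i < N - e ∧ i ∉ A := by
      funext i
      rw [posUp_mem_rowStrip, show (2 * e + 1) / 2 = e by omega]
    have h2 : (fun i => posDn (2 * e) i ∈ rowStrip N (2 * e) A B) =
        fun i => i < N - e ∧ i ∉ insert (N - e - 1) B := by
      funext i
      rw [posDn_mem_rowStrip, Finset.mem_insert, show (2 * e + 2) / 2 = e + 1 by omega]
      simp only [eq_iff_iff]
      constructor
      · rintro ⟨h, h'⟩
        exact ⟨by omega, fun hc => hc.elim (by omega) h'⟩
      · rintro ⟨h, h'⟩
        rw [not_or] at h'
        exact ⟨by omega, h'.2⟩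
    rw [h1, h2]
    rfl
  · exact posUp_injective _
  · exact posDn_injective _
  · exact fun i j => posUp_ne_posDn _ _ _ _
  · intro i t
    have h1 : upHalf (((i : ℤ) - e, 2 * (e : ℤ)), ((i : ℤ) - e, 2 * (e : ℤ))) =
        posUp (2 * e) i := by
      simp only [upHalf, posUp, upT, Prod.mk.injEq, true_and]; omega
    have h2 : dnHalf (((i : ℤ) - e, 2 * (e : ℤ)), ((i : ℤ) - e, 2 * (e : ℤ))) =
        posDn (2 * e) i := by
      simp only [dnHalf, posDn, dnT, Prod.mk.injEq, true_and]; omega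
    rw [h1, h2]
  · intro i t
    have h1 : upHalf (((i : ℤ) + 1 - e, 2 * (e : ℤ)), ((i : ℤ) - e, 2 * (e : ℤ))) =
        posUp (2 * e) (i + 1) := by
      simp only [upHalf, posUp, upT, Prod.mk.injEq, true_and]; omega
    have h2 : dnHalf (((i : ℤ) + 1 - e, 2 * (e : ℤ)), ((i : ℤ) - e, 2 * (e : ℤ))) =
        posDn (2 * e) i := by
      simp only [dnHalf, posDn, dnT, Prod.mk.injEq, true_and]; omega
    rw [h1, h2, or_comm]
  · intro i; exact Or.inl rfl
  · intro i; refine Or.inr (Or.inl ?_); ext <;> simp; omega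
  · exact fun t ht => exists_of_mem_rowStrip ht
  · intro l hl h1 h2
    obtain ⟨a, ha⟩ := upHalf_mem_rowStrip h1
    obtain ⟨b, hb⟩ := dnHalf_mem_rowStrip h2
    clear h1 h2
    obtain ⟨l1, l2⟩ := l
    simp only [lozAdj] at hl ha hb
    subst ha hb
    refine ⟨b, ?_⟩
    simp only [Prod.mk.injEq] at *
    omega

open Classical in
lemma Mtil_rowStrip_odd (N e : ℕ) (A B : Finset ℕ) :
    Mtil (rowStrip N (2 * e + 1) A B) ∅ =
      if HasPathMatching (N - (e + 1)) B A then 1 else 0 := by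
  rw [Mtil_eq_ite_isPathMatching (x := posDn (2 * e + 1)) (y := posUp (2 * e + 1))
    (lL := fun i => (((i : ℤ) - e, 2 * (e : ℤ) + 1), ((i : ℤ) - e - 1, 2 * (e : ℤ) + 1)))
    (lR := fun i => (((i : ℤ) - e, 2 * (e : ℤ) + 1), ((i : ℤ) - e, 2 * (e : ℤ) + 1)))]
  · have h1 : (fun i => posUp (2 * e + 1) i ∈ rowStrip N (2 * e + 1) A B) =
        fun i => i < N - (e + 1) ∧ i ∉ A := by
      funext i
      rw [posUp_mem_rowStrip, show (2 * e + 1 + 1) / 2 = e + 1 by omega]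
    have h2 : (fun i => posDn (2 * e + 1) i ∈ rowStrip N (2 * e + 1) A B) =
        fun i => i < N - (e + 1) ∧ i ∉ B := by
      funext i
      rw [posDn_mem_rowStrip, show (2 * e + 1 + 2) / 2 = e + 1 by omega]
    rw [h1, h2]
    rfl
  · exact posDn_injective _
  · exact posUp_injective _
  · exact fun i j => (posUp_ne_posDn _ _ _ _).symm
  · intro i t
    have h1 : upHalf (((i : ℤ) - e, 2 * (e : ℤ) + 1), ((i : ℤ) - e - 1, 2 * (e : ℤ) + 1)) =
        posUp (2 * e + 1) i := by
      simp only [upHalf, posUp, upT, Prod.mk.injEq, true_and]; omega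
    have h2 : dnHalf (((i : ℤ) - e, 2 * (e : ℤ) + 1), ((i : ℤ) - e - 1, 2 * (e : ℤ) + 1)) =
        posDn (2 * e + 1) i := by
      simp only [dnHalf, posDn, dnT, Prod.mk.injEq, true_and]; omega
    rw [h1, h2, or_comm]
  · intro i t
    have h1 : upHalf (((i : ℤ) - e, 2 * (e : ℤ) + 1), ((i : ℤ) - e, 2 * (e : ℤ) + 1)) =
        posUp (2 * e + 1) i := by
      simp only [upHalf, posUp, upT, Prod.mk.injEq, true_and]; omega
    have h2 : dnHalf (((i : ℤ) - e, 2 * (e : ℤ) + 1), ((i : ℤ) - e, 2 * (e : ℤ) + 1)) =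
        posDn (2 * e + 1) (i + 1) := by
      simp only [dnHalf, posDn, dnT, Prod.mk.injEq, true_and]; omega
    rw [h1, h2]
  · intro i; exact Or.inr (Or.inl rfl)
  · intro i; exact Or.inl rfl
  · intro t ht
    obtain ⟨i, h⟩ := exists_of_mem_rowStrip ht
    exact ⟨i, h.symm⟩
  · intro l hl h1 h2
    obtain ⟨a, ha⟩ := upHalf_mem_rowStrip h1
    obtain ⟨b, hb⟩ := dnHalf_mem_rowStrip h2
    clear h1 h2
    obtain ⟨l1, l2⟩ := l
    simp only [lozAdj] at hl ha hb
    subst ha hb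
    refine ⟨a, ?_⟩
    simp only [Prod.mk.injEq] at *
    omega

/-- The lozenges crossing the lattice line at height `j + 1`. -/
def crossLoz (j a : ℕ) : Loz :=
  (((a : ℤ) - (((j + 1) / 2 : ℕ) : ℤ), (j : ℤ) + 1), ((a : ℤ) - (((j + 1) / 2 : ℕ) : ℤ), (j : ℤ)))

lemma upHalf_crossLoz (j a : ℕ) : upHalf (crossLoz j a) = posUp (j + 1) a := by
  simp [upHalf, crossLoz, posUp]

lemma dnHalf_crossLoz (j a : ℕ) : dnHalf (crossLoz j a) = posDn j a := by
  simp [dnHalf, crossLoz, posDn]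

lemma crossLoz_injective (j : ℕ) : Function.Injective (crossLoz j) := by
  intro a b h
  simp only [crossLoz, Prod.mk.injEq] at h
  omega

lemma mem_rowsFrom {N m j : ℕ} {t : Tri} : t ∈ rowsFrom N m j ↔
    ∃ i, (j ≤ i ∧ i < m) ∧ t ∈ rowStrip N i ∅ ∅ := by
  simp [rowsFrom]

lemma rowStrip_height {N j : ℕ} {A B : Finset ℕ} {t : Tri} (h : t ∈ rowStrip N j A B) :
    t.2.2 = j := by
  obtain ⟨a, rfl | rfl⟩ := exists_of_mem_rowStrip h <;> rfl

lemma rowStrip_sdiff_dn (N j : ℕ) (A B : Finset ℕ) :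
    rowStrip N j A ∅ \ B.image (posDn j) = rowStrip N j A B := by
  ext t
  constructor
  · intro h
    obtain ⟨h1, h2⟩ := Finset.mem_sdiff.1 h
    obtain ⟨a, rfl | rfl⟩ := exists_of_mem_rowStrip h1
    · rw [posUp_mem_rowStrip] at *; exact h1
    · rw [(posDn_injective j).mem_finset_image] at h2
      rw [posDn_mem_rowStrip] at *; exact ⟨h1.1, h2⟩
  · intro h
    rw [Finset.mem_sdiff]
    obtain ⟨a, rfl | rfl⟩ := exists_of_mem_rowStrip h
    · rw [posUp_mem_rowStrip] at *
      refine ⟨h, fun hc => ?_⟩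
      obtain ⟨b, -, h⟩ := Finset.mem_image.1 hc
      exact posUp_ne_posDn _ _ _ _ h.symm
    · rw [(posDn_injective j).mem_finset_image]
      rw [posDn_mem_rowStrip] at *
      exact ⟨⟨h.1, by simp⟩, h.2⟩

lemma rowStrip_sdiff_up (N j : ℕ) (A : Finset ℕ) :
    rowStrip N j ∅ ∅ \ A.image (posUp j) = rowStrip N j A ∅ := by
  ext t
  constructor
  · intro h
    obtain ⟨h1, h2⟩ := Finset.mem_sdiff.1 h
    obtain ⟨a, rfl | rfl⟩ := exists_of_mem_rowStrip h1
    · rw [(posUp_injective j).mem_finset_image] at h2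
      rw [posUp_mem_rowStrip] at *; exact ⟨h1.1, h2⟩
    · rw [posDn_mem_rowStrip] at *; exact h1
  · intro h
    rw [Finset.mem_sdiff]
    obtain ⟨a, rfl | rfl⟩ := exists_of_mem_rowStrip h
    · rw [(posUp_injective j).mem_finset_image]
      rw [posUp_mem_rowStrip] at *
      exact ⟨⟨h.1, by simp⟩, h.2⟩
    · rw [posDn_mem_rowStrip] at *
      refine ⟨h, fun hc => ?_⟩
      obtain ⟨b, -, h⟩ := Finset.mem_image.1 hc
      exact posUp_ne_posDn _ _ _ _ h

lemma rowsFrom_sdiff {N m j : ℕ} (hj : j < m) (A : Finset ℕ) :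
    rowsFrom N m j \ A.image (posUp j) = rowsFrom N m (j + 1) ∪ rowStrip N j A ∅ := by
  rw [← rowStrip_sdiff_up]
  have h1 : rowsFrom N m j = rowsFrom N m (j + 1) ∪ rowStrip N j ∅ ∅ := by
    unfold rowsFrom
    rw [← Finset.insert_Ico_add_one_left_eq_Ico hj, Finset.biUnion_insert, Finset.union_comm]
  have h2 : rowsFrom N m (j + 1) \ A.image (posUp j) = rowsFrom N m (j + 1) := by
    rw [Finset.sdiff_eq_self_iff_disjoint, Finset.disjoint_left]
    intro t ht h
    obtain ⟨i, hi, ht⟩ := mem_rowsFrom.1 ht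
    obtain ⟨a, -, rfl⟩ := Finset.mem_image.1 h
    have := rowStrip_height ht
    simp only [posUp, upT] at this
    omega
  rw [h1, Finset.union_sdiff_distrib, h2]

lemma rowsFrom_height {N m j : ℕ} {t : Tri} (h : t ∈ rowsFrom N m j) : (j : ℤ) ≤ t.2.2 := by
  obtain ⟨i, hi, ht⟩ := mem_rowsFrom.1 h
  have := rowStrip_height ht
  omega

lemma posUp_mem_rowsFrom {N m j a : ℕ} :
    posUp j a ∈ rowsFrom N m j ↔ j < m ∧ a < N - (j + 1) / 2 := by
  rw [mem_rowsFrom]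
  constructor
  · rintro ⟨i, hi, ht⟩
    have := rowStrip_height ht
    obtain rfl : j = i := by simp only [posUp, upT] at this; omega
    exact ⟨hi.2, (posUp_mem_rowStrip.1 ht).1⟩
  · rintro ⟨h1, h2⟩
    exact ⟨j, ⟨le_rfl, h1⟩, posUp_mem_rowStrip.2 ⟨h2, by simp⟩⟩

/-- Peeling off the lowest row of a quartered hexagon. -/
lemma Mtil_rowsFrom_eq_sum {N m j : ℕ} (hj : j + 1 < m) (A : Finset ℕ) :
    Mtil (rowsFrom N m j \ A.image (posUp j)) ∅ =
      ∑ B ∈ (range (N - (j + 2) / 2)).powerset, Mtil (rowStrip N j A B) ∅ *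
        Mtil (rowsFrom N m (j + 1) \ B.image (posUp (j + 1))) ∅ := by
  rw [rowsFrom_sdiff (by omega), Mtil_union_eq_sum ∅ ((range (N - (j + 2) / 2)).image (crossLoz j))]
  · rw [Finset.powerset_image, Finset.sum_image]
    · refine Finset.sum_congr rfl fun B _ => ?_
      have h1 : (B.image (crossLoz j)).image upHalf = B.image (posUp (j + 1)) := by
        simp [Finset.image_image, Function.comp_def, upHalf_crossLoz]
      have h2 : (B.image (crossLoz j)).image dnHalf = B.image (posDn j) := by
        simp [Finset.image_image, Function.comp_def, dnHalf_crossLoz]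
      rw [h1, h2, rowStrip_sdiff_dn, mul_comm]
    · exact (Finset.image_injective (crossLoz_injective j)).injOn
  · rw [Finset.disjoint_left]
    intro t h1 h2
    have := rowsFrom_height h1; have := rowStrip_height h2
    push_cast at *
    omega
  · intro l
    simp only [Finset.mem_image, Finset.mem_range, Finset.notMem_empty, not_false_eq_true,
      true_and]
    constructor
    · rintro ⟨a, ha, rfl⟩
      rw [upHalf_crossLoz, dnHalf_crossLoz, posUp_mem_rowsFrom, posDn_mem_rowStrip]
      refine ⟨Or.inr (Or.inr ?_), ⟨hj, ha⟩, ha, by simp⟩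
      simp [crossLoz]
    · rintro ⟨h1, h2, h3⟩
      have h4 := rowsFrom_height h2
      have h5 := dnHalf_mem_rowStrip h3
      obtain ⟨a, h5⟩ := h5
      obtain ⟨⟨l1, l2⟩, l3, l4⟩ := l
      have : (l1, l2) = ((a : ℤ) - (((j + 1) / 2 : ℕ) : ℤ), (j : ℤ) + 1) := by
        simp only [lozAdj, upHalf, upT, Prod.mk.injEq] at *
        push_cast at *
        omega
      have e : crossLoz j a = ((l1, l2), (l3, l4)) := by
        rw [crossLoz, this]; simp only at h5; rw [h5]
      rw [← e, dnHalf_crossLoz, posDn_mem_rowStrip] at h3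
      exact ⟨a, h3.1, e⟩
  · intro l h1 h2 h3
    have h4 := rowsFrom_height h3
    have h5 := rowStrip_height h2
    simp only [lozAdj, upHalf, upT, dnHalf, dnT] at *
    obtain ⟨⟨l1, l2⟩, l3, l4⟩ := l
    simp only [Prod.mk.injEq] at *
    push_cast at *
    omega
  · intro l hl l' hl' h
    obtain ⟨a, -, rfl⟩ := Finset.mem_image.1 hl
    obtain ⟨b, -, rfl⟩ := Finset.mem_image.1 hl'
    rw [upHalf_crossLoz, upHalf_crossLoz, dnHalf_crossLoz, dnHalf_crossLoz] at h
    rw [h.elim (fun h => posUp_injective _ h) (fun h => posDn_injective _ h)]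

open Classical in
lemma Mtil_rowsFrom_even {N m e : ℕ} (he : e < N) (hm : 2 * e + 1 < m) (A : Finset ℕ) :
    (Mtil (rowsFrom N m (2 * e) \ A.image (posUp (2 * e))) ∅ : ℚ) =
      ∑ B ∈ (range (N - e - 1)).powerset,
        (if HasPathMatching (N - e - 1 + 1) A (insert (N - e - 1) B) then 1 else 0) *
          (Mtil (rowsFrom N m (2 * e + 1) \ B.image (posUp (2 * e + 1))) ∅ : ℚ) := by
  rw [Mtil_rowsFrom_eq_sum hm, show N - (2 * e + 2) / 2 = N - e - 1 by omega]
  push_cast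
  refine Finset.sum_congr rfl fun B _ => ?_
  rw [Mtil_rowStrip_even he, show N - e - 1 + 1 = N - e by omega]
  push_cast
  rfl

open Classical in
lemma Mtil_rowsFrom_odd {N m e : ℕ} (hm : 2 * e + 2 < m) (B : Finset ℕ) :
    (Mtil (rowsFrom N m (2 * e + 1) \ B.image (posUp (2 * e + 1))) ∅ : ℚ) =
      ∑ A ∈ (range (N - (e + 1))).powerset,
        (if HasPathMatching (N - (e + 1)) A B then 1 else 0) *
          (Mtil (rowsFrom N m (2 * (e + 1)) \ A.image (posUp (2 * (e + 1)))) ∅ : ℚ) := by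
  rw [Mtil_rowsFrom_eq_sum hm, show N - (2 * e + 1 + 2) / 2 = N - (e + 1) by omega]
  push_cast
  refine Finset.sum_congr rfl fun A _ => ?_
  rw [Mtil_rowStrip_odd]
  push_cast
  rfl

open Classical in
lemma Mtil_rowsFrom_last {N e : ℕ} (he : e < N) (A : Finset ℕ) :
    Mtil (rowsFrom N (2 * e + 1) (2 * e) \ A.image (posUp (2 * e))) ∅ =
      if HasPathMatching (N - e) A {N - e - 1} then 1 else 0 := by
  rw [rowsFrom_sdiff (by omega)]
  have : rowsFrom N (2 * e + 1) (2 * e + 1) = ∅ := by simp [rowsFrom]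
  rw [this, Finset.empty_union, Mtil_rowStrip_even he]
  rfl

lemma Mtil_rowsFrom_eq_evenDet {N : ℕ} (k : ℕ) : ∀ e, e + k + 1 ≤ N →
    ∀ a : Fin (k + 1) → ℕ, StrictMono a → (∀ j, a j < N - e) →
    (Mtil (rowsFrom N (2 * e + 2 * k + 1) (2 * e) \
      (univ.image a).image (posUp (2 * e))) ∅ : ℚ) = evenDet a := by
  induction k with
  | zero =>
    intro e he a ha haN
    rw [Nat.mul_zero, Nat.add_zero, Mtil_rowsFrom_last (by omega), if_pos]
    · simp [evenDet]
    · have hb : StrictMono (fun _ : Fin 1 => N - e - 1) := fun i j h =>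
        absurd h (by omega)
      have := (hasPathMatching_iff ha hb haN (fun _ => by omega)).2
        ⟨fun j => by have := haN j; omega, fun i j h =>
          absurd h (by omega)⟩
      simpa using this
  | succ k ih =>
    intro e he a ha haN
    rw [Mtil_rowsFrom_even (by omega) (by omega),
      sum_hasPathMatching_right ha (fun j => by have := haN j; omega)
        (f := fun B => (Mtil (rowsFrom N (2 * e + 2 * (k + 1) + 1) (2 * e + 1) \
          B.image (posUp (2 * e + 1))) ∅ : ℚ)),
      ← sum_oddDet a ha.monotone]
    refine Finset.sum_congr rfl fun b hb => ?_
    have hbs := strictMono_of_mem_piFinset_Ico ha hb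
    have hbN : ∀ j, b j < N - (e + 1) :=
      lt_of_mem_piFinset_Ico (fun j => by have := haN j; omega) hb
    rw [Mtil_rowsFrom_odd (by omega), sum_hasPathMatching_left hbs hbN
        (f := fun A => (Mtil (rowsFrom N (2 * e + 2 * (k + 1) + 1) (2 * (e + 1)) \
          A.image (posUp (2 * (e + 1)))) ∅ : ℚ)),
      ← sum_evenDet b hbs.monotone]
    refine Finset.sum_congr rfl fun c hc => ?_
    have hc' := (mem_piFinset_Ico_vecCons_iff hbs).1 hc
    rw [← ih (e + 1) (by omega) c (strictMono_of_interlace hc')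
      (fun j => (hc'.1 j).trans_lt (hbN j))]
    rw [show 2 * e + 2 * (k + 1) + 1 = 2 * (e + 1) + 2 * k + 1 by ring]

lemma Mtil_rowsFrom_eq_zero {N : ℕ} (k : ℕ) : ∀ e, e + k + 1 ≤ N →
    ∀ A ⊆ range (N - e), #A ≠ k + 1 →
    (Mtil (rowsFrom N (2 * e + 2 * k + 1) (2 * e) \ A.image (posUp (2 * e))) ∅ : ℚ) = 0 := by
  have hins : ∀ {e : ℕ}, e < N → ∀ B ⊆ range (N - e - 1),
      insert (N - e - 1) B ⊆ range (N - e) ∧ #(insert (N - e - 1) B) = #B + 1 := by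
    intro e he B hB
    refine ⟨fun i hi => ?_, Finset.card_insert_of_notMem fun h => by simpa using hB h⟩
    rcases Finset.mem_insert.1 hi with rfl | hi
    · exact Finset.mem_range.2 (by omega)
    · have := Finset.mem_range.1 (hB hi)
      exact Finset.mem_range.2 (by omega)
  induction k with
  | zero =>
    intro e he A hA hc
    rw [Nat.mul_zero, Nat.add_zero, Mtil_rowsFrom_last (by omega), if_neg, Nat.cast_zero]
    intro h
    have := h.card_eq hA (hins (by omega) ∅ (by simp)).1
    exact hc (by simpa using this)
  | succ k ih =>
    intro e he A hA hc
    rw [Mtil_rowsFrom_even (by omega) (by omega)]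
    refine Finset.sum_eq_zero fun B hB => ?_
    rw [Finset.mem_powerset] at hB
    have hBi := hins (by omega) B hB
    split_ifs with h
    · rw [Nat.sub_add_cancel (by omega)] at h
      have h1 := h.card_eq hA hBi.1
      rw [Mtil_rowsFrom_odd (by omega), Finset.sum_eq_zero, mul_zero]
      intro C hC
      rw [Finset.mem_powerset] at hC
      split_ifs with h'
      · have h2 := h'.card_eq hC (by rwa [← Nat.sub_sub])
        rw [show 2 * e + 2 * (k + 1) + 1 = 2 * (e + 1) + 2 * k + 1 by ring,
          ih (e + 1) (by omega) C hC (by omega), mul_zero]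
      · rw [zero_mul]
    · rw [zero_mul]

lemma upDents_eq_image {A : Finset ℕ} (hA : ∀ p ∈ A, 1 ≤ p) :
    upDents A = (A.image fun p => p - 1).image (posUp 0) := by
  rw [Finset.image_image]
  refine Finset.image_congr fun p hp => ?_
  have := hA p hp
  simp [posUp, Nat.cast_sub this]

lemma Lreg_eq (m n : ℕ) (A : Finset ℕ) :
    Lreg m n A = rowsFrom (n + (m + 1) / 2) m 0 \ upDents A := by
  unfold Lreg rowsFrom rowStrip
  rw [← Finset.range_eq_Ico]
  congr 1
  refine Finset.biUnion_congr rfl fun j _ => ?_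
  rw [Finset.sdiff_empty, Finset.sdiff_empty,
    show n + (m + 1) / 2 + j / 2 - j = n + (m + 1) / 2 - (j + 1) / 2 by omega,
    show n + (m + 1) / 2 + (j + 1) / 2 - (j + 1) = n + (m + 1) / 2 - (j + 2) / 2 by omega]
  rfl

/-- The normalizing constant in the tiling formula for quartered hexagons. -/
def quarterConst (k : ℕ) : ℚ := (∏ r : Fin k, ((2 * r : ℕ).factorial : ℚ))⁻¹

/-- The coordinate in which the tiling formula for quartered hexagons is a Vandermonde product. -/
def quarterCoord (p : ℕ) : ℚ := p * (p - 1)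

/-- The tiling formula for quartered hexagons. -/
lemma Mtil_Lreg {M n : ℕ} {A : Finset ℕ} (hA : A ⊆ Icc 1 (n + M)) (hM : 0 < M ∨ A = ∅) :
    (Mtil (Lreg (2 * M - 1) n A) ∅ : ℚ) =
      if #A = M then quarterConst M * vandSet quarterCoord A else 0 := by
  rcases M with _ | k
  · obtain rfl : A = ∅ := by simpa using hM
    have : Lreg (2 * 0 - 1) n ∅ = ∅ := by simp [Lreg]
    rw [this, Mtil_empty]
    simp [quarterConst, vandSet]
  have hA1 : ∀ p ∈ A, 1 ≤ p ∧ p ≤ n + (k + 1) := fun p hp => Finset.mem_Icc.1 (hA hp)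
  set A' := A.image fun p => p - 1 with hA'
  have hcard : #A' = #A := by
    refine Finset.card_image_of_injOn fun p hp q hq h => ?_
    have := hA1 p hp; have := hA1 q hq
    omega
  have hsub : A' ⊆ range (n + (k + 1) - 0) := by
    intro a ha
    obtain ⟨p, hp, rfl⟩ := Finset.mem_image.1 ha
    have := hA1 p hp
    rw [Finset.mem_range]; omega
  have hL : Lreg (2 * (k + 1) - 1) n A = rowsFrom (n + (k + 1)) (2 * 0 + 2 * k + 1) (2 * 0) \
      A'.image (posUp (2 * 0)) := by
    rw [Lreg_eq, upDents_eq_image fun p hp => (hA1 p hp).1,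
      show n + (2 * (k + 1) - 1 + 1) / 2 = n + (k + 1) by omega,
      show 2 * (k + 1) - 1 = 2 * 0 + 2 * k + 1 by omega]
  rw [hL]
  split_ifs with h
  · obtain ⟨a, ha, haA⟩ := exists_strictMono_image_eq (hcard.trans h)
    have hAa : A = univ.image fun i => a i + 1 := by
      have : A = A'.image fun i => i + 1 := by
        rw [hA', Finset.image_image]
        conv_lhs => rw [← Finset.image_id (s := A)]
        refine Finset.image_congr fun p hp => ?_
        have := hA1 p hp
        simp only [id, Function.comp]
        omega
      rw [this, haA, Finset.image_image]
      rfl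
    rw [haA, Mtil_rowsFrom_eq_evenDet k 0 (by omega) a ha, evenDet_eq, quarterConst, hAa,
      vandSet_image _ _ fun i j h => ha.injective (by simpa using h), vandProd, abs_of_nonneg]
    · congr 1
      refine Finset.prod_congr rfl fun i _ => Finset.prod_congr rfl fun j _ => ?_
      simp only [quarterCoord]
      push_cast
      ring
    · refine Finset.prod_nonneg fun i _ => Finset.prod_nonneg fun j hj => ?_
      have : (a i : ℚ) < a j := by exact_mod_cast ha (Finset.mem_Ioi.1 hj)
      have : (0 : ℚ) ≤ a i := Nat.cast_nonneg _
      simp only [quarterCoord]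
      push_cast
      nlinarith
    · intro j
      simpa using hsub (haA ▸ Finset.mem_image_of_mem a (mem_univ j))
  · exact Mtil_rowsFrom_eq_zero k 0 (by omega) A' hsub (hcard ▸ h)

lemma Lreg_sdiff_upDents (m n : ℕ) (A S : Finset ℕ) :
    Lreg m n A \ upDents S = Lreg m n (A ∪ S) := by
  rw [Lreg_eq, Lreg_eq, sdiff_sdiff_left, upDents, upDents, upDents, Finset.image_union]
  rfl

lemma upT_zero_mem_Lreg {m n : ℕ} {A : Finset ℕ} {p : ℤ} : upT p 0 ∈ Lreg m n A ↔
    0 < m ∧ ∃ i ∈ Icc 1 (n + (m + 1) / 2) \ A, p = (i : ℤ) - 1 := by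
  rw [Lreg_eq, Finset.mem_sdiff]
  constructor
  · rintro ⟨h1, h2⟩
    obtain ⟨j, hj, h⟩ := mem_rowsFrom.1 h1
    have hj0 := rowStrip_height h
    obtain rfl : j = 0 := by simp only [upT] at hj0; omega
    obtain ⟨a, ha | ha⟩ := exists_of_mem_rowStrip h
    · rw [ha, posUp_mem_rowStrip] at h
      have hp : p = a := by simpa [posUp, upT] using ha
      refine ⟨hj.2, a + 1, ?_, by omega⟩
      refine Finset.mem_sdiff.2 ⟨Finset.mem_Icc.2 ⟨by omega, by omega⟩, fun hc => h2 ?_⟩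
      exact Finset.mem_image.2 ⟨a + 1, hc, by simp [hp]⟩
    · simp [posDn, upT, dnT] at ha
  · rintro ⟨hm, i, hi, rfl⟩
    obtain ⟨hi1, hi2⟩ := Finset.mem_sdiff.1 hi
    rw [Finset.mem_Icc] at hi1
    have e : upT ((i : ℤ) - 1) 0 = posUp 0 (i - 1) := by
      simp [posUp, Nat.cast_sub hi1.1]
    refine ⟨?_, fun hc => ?_⟩
    · rw [e, posUp_mem_rowsFrom]
      exact ⟨hm, by omega⟩
    · obtain ⟨q, hq, h⟩ := Finset.mem_image.1 hc
      simp only [upT, Prod.mk.injEq, and_true, true_and] at h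
      obtain rfl : q = i := by omega
      exact hi2 hq

lemma Lreg_height {m n : ℕ} {A : Finset ℕ} {t : Tri} (h : t ∈ Lreg m n A) : 0 ≤ t.2.2 := by
  rw [Lreg_eq] at h
  simpa using rowsFrom_height (Finset.mem_sdiff.1 h).1

end HexagonRows

section HalvedHexagons

lemma reflTri_injective : Function.Injective reflTri :=
  Function.LeftInverse.injective reflTri_reflTri

lemma mem_image_reflTri {R : Finset Tri} {t : Tri} : t ∈ R.image reflTri ↔ reflTri t ∈ R := by
  rw [← reflTri_injective.mem_finset_image (s := R), reflTri_reflTri]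

lemma dnDents_eq_image (D : Finset ℕ) : dnDents D = (upDents D).image reflTri := by
  rw [dnDents, upDents, Finset.image_image]
  refine Finset.image_congr fun i _ => ?_
  simp [reflTri, upT, dnT]

/-- The lozenge straddling the horizontal axis at position `i`. -/
def axisLoz (i : ℕ) : Loz := (((i : ℤ) - 1, 0), ((i : ℤ) - 1, -1))

lemma axisLoz_injective : Function.Injective axisLoz := by
  intro a b h
  simp only [axisLoz, Prod.mk.injEq] at h
  omega

lemma mem_barrierLoz {B : Finset ℕ} {l : Loz} : l ∈ barrierLoz B ↔ ∃ i ∈ B, axisLoz i = l := by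
  simp [barrierLoz, axisLoz]

/-- The positions at which a tiling of a halved hexagon may cross the axis. -/
def crossPos (N : ℕ) (U D B : Finset ℕ) : Finset ℕ := Icc 1 N \ (U ∪ D ∪ B)

lemma Mtil_Lreg_union {y n : ℕ} {U S : Finset ℕ} (hUS : Disjoint U S)
    (hU : U ∪ S ⊆ Icc 1 (n + (y + #U))) (h : 0 < y + #U ∨ S = ∅) :
    (Mtil (Lreg (2 * (y + #U) - 1) n (U ∪ S)) ∅ : ℚ) =
      if #S = y then quarterConst (y + #U) * vandSet quarterCoord (U ∪ S) else 0 := by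
  rw [Mtil_Lreg hU]
  · have := Finset.card_union_of_disjoint hUS
    refine if_congr ?_ rfl rfl
    omega
  · rcases h with h | rfl
    · exact Or.inl h
    · rw [Finset.union_empty]
      by_cases hU : U = ∅
      · exact Or.inr hU
      · have := Finset.card_pos.2 (Finset.nonempty_iff_ne_empty.2 hU)
        omega

/-- The tiling formula for doubly-dented halved hexagons with barriers. -/
lemma Mtil_Fbar {x y n : ℕ} {U D B : Finset ℕ} (hU : U ⊆ Icc 1 (x + y + n))
    (hD : D ⊆ Icc 1 (x + y + n)) (hUn : #U ≤ x + n) (hDn : #D ≤ x + n) :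
    (Mtil (Fbar x y n U D) (barrierLoz B) : ℚ) =
      quarterConst (y + #U) * quarterConst (y + #D) *
        dentSum quarterCoord y U D (crossPos (x + y + n) U D B) := by
  classical
  set C := crossPos (x + y + n) U D B with hC
  have hCm : ∀ i ∈ C, i ∈ Icc 1 (x + y + n) ∧ i ∉ U ∧ i ∉ D ∧ i ∉ B := by
    intro i hi
    simpa [hC, crossPos, and_assoc] using hi
  have hFb : Fbar x y n U D = Lreg (2 * (y + #U) - 1) (x + n - #U) U ∪
      (Lreg (2 * (y + #D) - 1) (x + n - #D) D).image reflTri := by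
    rw [Fbar, mul_add, mul_add]
  set I : Finset ℕ := if 0 < y + #U ∧ 0 < y + #D then C else ∅ with hI
  have hIC : I ⊆ C := by rw [hI]; split_ifs <;> simp
  have hIpos : ∀ i ∈ I, 0 < y + #U ∧ 0 < y + #D := by
    intro i hi; rw [hI] at hi; split_ifs at hi with h
    · exact h
    · simp at hi
  have hup : ∀ i, upHalf (axisLoz i) = upT ((i : ℤ) - 1) 0 := fun i => rfl
  have hdn : ∀ i, dnHalf (axisLoz i) = reflTri (upT ((i : ℤ) - 1) 0) := fun i => by
    simp [dnHalf, axisLoz, reflTri, upT, dnT]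
  set R₁ := Lreg (2 * (y + #U) - 1) (x + n - #U) U with hR₁
  set R₂ := (Lreg (2 * (y + #D) - 1) (x + n - #D) D).image reflTri with hR₂
  have h1 : ∀ t ∈ R₁, 0 ≤ t.2.2 := fun t => Lreg_height
  have h2 : ∀ t ∈ R₂, t.2.2 < 0 := by
    intro t ht
    have := Lreg_height (mem_image_reflTri.1 ht)
    unfold reflTri at this
    split_ifs at this <;> simp only at this <;> omega
  have hm1 : ∀ p, upT p 0 ∈ R₁ ↔ 0 < y + #U ∧ ∃ i ∈ Icc 1 (x + y + n) \ U, p = (i : ℤ) - 1 := by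
    intro p
    rw [hR₁, upT_zero_mem_Lreg]
    rw [show x + n - #U + (2 * (y + #U) - 1 + 1) / 2 = x + y + n by omega]
    exact and_congr (by omega) Iff.rfl
  have hm2 : ∀ p, reflTri (upT p 0) ∈ R₂ ↔
      0 < y + #D ∧ ∃ i ∈ Icc 1 (x + y + n) \ D, p = (i : ℤ) - 1 := by
    intro p
    rw [hR₂, reflTri_injective.mem_finset_image, upT_zero_mem_Lreg,
      show x + n - #D + (2 * (y + #D) - 1 + 1) / 2 = x + y + n by omega]
    exact and_congr (by omega) Iff.rfl
  have hcut := Mtil_union_eq_sum (R₁ := R₁) (R₂ := R₂) (barrierLoz B) (I.image axisLoz) ?_ ?_ ?_ ?_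
  · rw [hFb, hcut, Finset.powerset_image, Finset.sum_image
      (Finset.image_injective axisLoz_injective).injOn]
    have hterm : ∀ S ∈ I.powerset,
        (Mtil (R₁ \ (S.image axisLoz).image upHalf) (barrierLoz B) *
          Mtil (R₂ \ (S.image axisLoz).image dnHalf) (barrierLoz B) : ℚ) =
        if #S = y then quarterConst (y + #U) * quarterConst (y + #D) *
          (vandSet quarterCoord (U ∪ S) * vandSet quarterCoord (D ∪ S)) else 0 := by
      intro S hS
      rw [Finset.mem_powerset] at hS
      have hSC := hS.trans hIC
      have e1 : R₁ \ (S.image axisLoz).image upHalf =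
          Lreg (2 * (y + #U) - 1) (x + n - #U) (U ∪ S) := by
        rw [← Lreg_sdiff_upDents, Finset.image_image]
        rfl
      have e2 : R₂ \ (S.image axisLoz).image dnHalf =
          (Lreg (2 * (y + #D) - 1) (x + n - #D) (D ∪ S)).image reflTri := by
        rw [← Lreg_sdiff_upDents, Finset.image_sdiff _ _ reflTri_injective, ← dnDents_eq_image,
          Finset.image_image]
        rfl
      have hS0 : S = ∅ ∨ 0 < y + #U ∧ 0 < y + #D := by
        rcases S.eq_empty_or_nonempty with h | ⟨i, hi⟩
        · exact Or.inl h
        · exact Or.inr (hIpos i (hS hi))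
      have hUS : Disjoint U S := Finset.disjoint_left.2 fun i hi hi' =>
        (hCm i (hSC hi')).2.1 hi
      have hDS : Disjoint D S := Finset.disjoint_left.2 fun i hi hi' =>
        (hCm i (hSC hi')).2.2.1 hi
      have hSN : S ⊆ Icc 1 (x + y + n) := fun i hi => (hCm i (hSC hi)).1
      have f1 : Mtil (R₁ \ (S.image axisLoz).image upHalf) (barrierLoz B) =
          Mtil (R₁ \ (S.image axisLoz).image upHalf) ∅ := by
        refine Mtil_eq_of_disjoint fun l hl _ hc => ?_
        obtain ⟨i, -, rfl⟩ := mem_barrierLoz.1 hl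
        have := h1 _ (Finset.mem_sdiff.1 hc).1
        simp [dnHalf, axisLoz, dnT] at this
      have f2 : Mtil (R₂ \ (S.image axisLoz).image dnHalf) (barrierLoz B) =
          Mtil (R₂ \ (S.image axisLoz).image dnHalf) ∅ := by
        refine Mtil_eq_of_disjoint fun l hl hc _ => ?_
        obtain ⟨i, -, rfl⟩ := mem_barrierLoz.1 hl
        have := h2 _ (Finset.mem_sdiff.1 hc).1
        simp [upHalf, axisLoz, upT] at this
      rw [f1, f2, e1, e2, Mtil_image_refl,
        Mtil_Lreg_union hUS (by
          rw [show x + n - #U + (y + #U) = x + y + n by omega]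
          exact Finset.union_subset hU hSN) (hS0.symm.imp_left And.left),
        Mtil_Lreg_union hDS (by
          rw [show x + n - #D + (y + #D) = x + y + n by omega]
          exact Finset.union_subset hD hSN) (hS0.symm.imp_left And.right)]
      split_ifs
      · ring
      · simp
    push_cast
    rw [Finset.sum_congr rfl hterm, ← Finset.sum_filter, ← Finset.powersetCard_eq_filter,
      ← Finset.mul_sum, dentSum]
    congr 1
    by_cases h : 0 < y + #U ∧ 0 < y + #D
    · rw [hI, if_pos h]
    · have : y = 0 := by omega
      subst this
      simp
  · rw [Finset.disjoint_left]
    intro t ht ht'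
    have := h1 t ht; have := h2 t ht'
    omega
  · intro l
    rw [Finset.mem_image, mem_barrierLoz]
    constructor
    · rintro ⟨i, hi, rfl⟩
      have hp := hIpos i hi
      have hC := hCm i (hIC hi)
      rw [hup, hdn, hm1, hm2]
      refine ⟨Or.inr (Or.inr rfl), ?_, ⟨hp.1, i, Finset.mem_sdiff.2 ⟨hC.1, hC.2.1⟩, rfl⟩,
        hp.2, i, Finset.mem_sdiff.2 ⟨hC.1, hC.2.2.1⟩, rfl⟩
      rintro ⟨j, hj, h⟩
      obtain rfl := axisLoz_injective h
      exact hC.2.2.2 hj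
    · rintro ⟨ha, hB, hu, hd⟩
      have hu' := h1 _ hu
      have hd' := h2 _ hd
      obtain ⟨⟨l1, l2⟩, l3, l4⟩ := l
      obtain ⟨rfl, rfl, rfl⟩ : l2 = 0 ∧ l4 = -1 ∧ l1 = l3 := by
        simp only [lozAdj, upHalf, dnHalf, upT, dnT, Prod.mk.injEq] at *
        omega
      have hd2 : dnHalf ((l1, 0), (l1, -1)) = reflTri (upT l1 0) := by
        simp [dnHalf, reflTri, upT, dnT]
      rw [hd2, hm2] at hd
      obtain ⟨hd0, i, hi, rfl⟩ := hd
      obtain ⟨hu0, j, hj, hij⟩ := (hm1 ((i : ℤ) - 1)).1 hu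
      obtain rfl : i = j := by omega
      refine ⟨i, ?_, rfl⟩
      rw [hI, if_pos ⟨hu0, hd0⟩, hC, crossPos]
      simp only [Finset.mem_sdiff, Finset.mem_union] at *
      exact ⟨hi.1, fun h => h.elim (fun h => h.elim hj.2 hi.2) fun h => hB ⟨i, h, rfl⟩⟩
  · intro l ha hu hd
    have hu' := h2 _ hu
    have hd' := h1 _ hd
    obtain ⟨⟨l1, l2⟩, l3, l4⟩ := l
    simp only [lozAdj, upHalf, dnHalf, upT, dnT, Prod.mk.injEq] at *
    omega
  · intro l hl l' hl' h
    obtain ⟨a, -, rfl⟩ := Finset.mem_image.1 hl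
    obtain ⟨b, -, rfl⟩ := Finset.mem_image.1 hl'
    rw [hup, hup, hdn, hdn, reflTri_injective.eq_iff, or_self] at h
    simp only [upT, Prod.mk.injEq] at h
    rw [show a = b by omega]

end HalvedHexagons

/-- **Recurrence (5.18)** for `F̄`-type halved hexagons, obtained by Kuo
condensation. -/
theorem kuo_recurrence_Fbar
    (x y n : ℕ) (hy : 0 < y)
    (U D B : Finset ℕ) (α β : ℕ)
    (hUsub : U ⊆ Finset.Icc 1 (x + y + n)) (hDsub : D ⊆ Finset.Icc 1 (x + y + n))
    (hn : (U ∪ D).card = n)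
    (hBsub : B ⊆ Finset.Icc 1 (x + y + n) \ (U ∪ D)) (hBc : B.card < x)
    (hα : α ∈ Finset.Icc 1 (x + y + n) \ (U ∪ D ∪ B))
    (hβ : β ∈ Finset.Icc 1 (x + y + n) \ (U ∪ D ∪ B))
    (hmin : ∀ s ∈ Finset.Icc 1 (x + y + n) \ (U ∪ D ∪ B), α ≤ s)
    (hmax : ∀ s ∈ Finset.Icc 1 (x + y + n) \ (U ∪ D ∪ B), s ≤ β)
    (hαβ : α < β) :
    Mtil (Fbar x y n U D) (barrierLoz B) *
        Mtil (Fbar (x - 1) (y - 1) (n + 2) (insert α (insert β U)) D) (barrierLoz B) =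
      Mtil (Fbar (x - 1) y (n + 1) (insert β U) D) (barrierLoz B) *
          Mtil (Fbar x (y - 1) (n + 1) (insert α U) D) (barrierLoz B) +
        Mtil (Fbar (x - 1) y (n + 1) (insert α U) D) (barrierLoz B) *
          Mtil (Fbar x (y - 1) (n + 1) (insert β U) D) (barrierLoz B) := by
  obtain ⟨y, rfl⟩ : ∃ y', y = y' + 1 := ⟨y - 1, by omega⟩
  obtain ⟨x, rfl⟩ : ∃ x', x = x' + 1 := ⟨x - 1, by omega⟩
  simp only [Nat.add_sub_cancel]
  set C := crossPos (x + 1 + (y + 1) + n) U D B with hC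
  change α ∈ C at hα
  change β ∈ C at hβ
  change ∀ s ∈ C, α ≤ s at hmin
  change ∀ s ∈ C, s ≤ β at hmax
  have hCm : ∀ i ∈ C, i ∈ Icc 1 (x + 1 + (y + 1) + n) ∧ i ∉ U ∧ i ∉ D ∧ i ∉ B := by
    intro i hi
    simpa [hC, crossPos, and_assoc] using hi
  have hUn : #U ≤ n := hn ▸ Finset.card_le_card Finset.subset_union_left
  have hDn : #D ≤ n := hn ▸ Finset.card_le_card Finset.subset_union_right
  have hN1 : x + (y + 1) + (n + 1) = x + 1 + (y + 1) + n := by ring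
  have hN2 : x + 1 + y + (n + 1) = x + 1 + (y + 1) + n := by ring
  have hN3 : x + y + (n + 2) = x + 1 + (y + 1) + n := by ring
  have hins : ∀ (V : Finset ℕ) (γ : ℕ), crossPos (x + 1 + (y + 1) + n) (insert γ V) D B =
      (crossPos (x + 1 + (y + 1) + n) V D B).erase γ := by
    intro V γ
    ext i
    simp only [crossPos, Finset.mem_sdiff, Finset.mem_union, Finset.mem_insert, Finset.mem_erase]
    tauto
  obtain ⟨hαN, hαU, -, -⟩ := hCm α hα
  obtain ⟨hβN, hβU, -, -⟩ := hCm β hβ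
  have hcα : #(insert α U) = #U + 1 := Finset.card_insert_of_notMem hαU
  have hcβ : #(insert β U) = #U + 1 := Finset.card_insert_of_notMem hβU
  have hcαβ : #(insert α (insert β U)) = #U + 2 := by
    rw [Finset.card_insert_of_notMem (by simp [hαβ.ne, hαU]), hcβ]
  have hUα := Finset.insert_subset hαN hUsub
  have hUβ := Finset.insert_subset hβN hUsub
  have hUαβ := Finset.insert_subset hαN hUβ
  have hmono : ∀ {p q : ℕ}, 1 ≤ p → p ≤ q → quarterCoord p ≤ quarterCoord q := by
    intro p q hp hpq
    have h1 : (1 : ℚ) ≤ p := by exact_mod_cast hp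
    have h2 : (p : ℚ) ≤ q := by exact_mod_cast hpq
    simp only [quarterCoord]
    nlinarith
  have key := dentSum_condensation quarterCoord y (U := U) (D := D) (C := C)
    (Finset.disjoint_left.2 fun i hi hi' => (hCm i hi').2.1 hi)
    (Finset.disjoint_left.2 fun i hi hi' => (hCm i hi').2.2.1 hi) hα hβ hαβ.ne
    (fun s hs => hmono (Finset.mem_Icc.1 hαN).1 (hmin s hs))
    (fun s hs => hmono (Finset.mem_Icc.1 (hCm s hs).1).1 (hmax s hs))
  rw [← Nat.cast_inj (R := ℚ)]
  push_cast
  rw [Mtil_Fbar hUsub hDsub (by omega) (by omega),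
    Mtil_Fbar (hN3 ▸ hUαβ) (hN3 ▸ hDsub) (by omega) (by omega),
    Mtil_Fbar (hN1 ▸ hUβ) (hN1 ▸ hDsub) (by omega) (by omega),
    Mtil_Fbar (hN2 ▸ hUα) (hN2 ▸ hDsub) (by omega) (by omega),
    Mtil_Fbar (hN1 ▸ hUα) (hN1 ▸ hDsub) (by omega) (by omega),
    Mtil_Fbar (hN2 ▸ hUβ) (hN2 ▸ hDsub) (by omega) (by omega),
    hN1, hN2, hN3, hins, hins, hins, Finset.erase_right_comm, hcα, hcβ, hcαβ, ← hC,
    show y + 1 + (#U + 1) = y + #U + 2 by ring, show y + (#U + 1) = y + #U + 1 by ring,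
    show y + 1 + #U = y + #U + 1 by ring, show y + (#U + 2) = y + #U + 2 by ring]
  linear_combination quarterConst (y + #U + 1) * quarterConst (y + 1 + #D) *
    quarterConst (y + #U + 2) * quarterConst (y + #D) * key
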